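/- arXiv:1502.03736 — 4 statements merged into one kernel-verified Lean document; each statement's English description precedes it below -/
import Mathlib

section
/- Let 𝕜 be an algebraically closed field, let n ≥ 1 and 1 ≤ k ≤ n be integers, and let b be a natural number. Let I ⊆ 𝕜[x₁,…,xₙ] be a homogeneous ideal such that N := dim_𝕜 𝕜[x₁,…,xₙ]/I is finite. Suppose that for every k-dimensional linear subspace V of 𝕜ⁿ one has dim_𝕜 𝕜[x₁,…,xₙ]/(I + I_V) ≥ binom(b, k). Then N ≥ binom(b + (n − k), n). -/
open MvPolynomial

/-- An ideal of the polynomial ring is homogeneous (with respect to the standard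
grading) if it contains all homogeneous components of each of its elements. -/
def IsHomogeneousIdeal {𝕜 : Type} [Field 𝕜] {n : ℕ}
    (I : Ideal (MvPolynomial (Fin n) 𝕜)) : Prop :=
  ∀ f ∈ I, ∀ d : ℕ, MvPolynomial.homogeneousComponent d f ∈ I

/-- The ideal of a linear subspace `V ⊆ 𝕜ⁿ` through the origin: generated by the
linear forms vanishing on `V`. -/
noncomputable def linearSubspaceIdeal (𝕜 : Type) [Field 𝕜] (n : ℕ)
    (V : Submodule 𝕜 (Fin n → 𝕜)) : Ideal (MvPolynomial (Fin n) 𝕜) :=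
  Ideal.span {f : MvPolynomial (Fin n) 𝕜 |
    f.IsHomogeneous 1 ∧ ∀ x ∈ V, MvPolynomial.eval x f = 0}

section CofiniteIdeals

variable {K : Type*} [Field K]

/-- A linear perturbation of `f` drops the rank of `f` for only finitely many parameters. -/
theorem finite_setOf_finrank_range_add_smul_lt {V : Type*} [AddCommGroup V] [Module K V]
    [FiniteDimensional K V] (f g : V →ₗ[K] V) :
    {t : K | Module.finrank K (LinearMap.range (f + t • g)) <
      Module.finrank K (LinearMap.range f)}.Finite := by
  classical
  obtain ⟨p, hp⟩ := f.rangeRestrict.exists_rightInverse_of_surjective f.range_rangeRestrict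
  obtain ⟨q, hq⟩ := (LinearMap.range f).subtype.exists_leftInverse_of_injective
    (Submodule.ker_subtype _)
  have hid : q ∘ₗ f ∘ₗ p = LinearMap.id := by
    ext x
    have h1 : f.rangeRestrict (p x) = x := LinearMap.congr_fun hp x
    have h2 : q (f.rangeRestrict (p x) : V) = f.rangeRestrict (p x) :=
      LinearMap.congr_fun hq (f.rangeRestrict (p x))
    rw [h1] at h2
    have h3 : f (p x) = (x : V) := congrArg Subtype.val h1
    simp [h3, h2]
  let h : LinearMap.range f →ₗ[K] LinearMap.range f := q ∘ₗ g ∘ₗ p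
  have hfin : {t : K | LinearMap.det (LinearMap.id + t • h) = 0}.Finite := by
    let b := Module.finBasis K (LinearMap.range f)
    let M := LinearMap.toMatrix b b h
    let P : Polynomial K := (1 + (Polynomial.X : Polynomial K) • M.map Polynomial.C).det
    have heval : ∀ t : K, P.eval t = LinearMap.det (LinearMap.id + t • h) := by
      intro t
      rw [← LinearMap.det_toMatrix b, map_add, map_smul, LinearMap.toMatrix_id,
        ← Polynomial.coe_evalRingHom, RingHom.map_det]
      congr 1
      ext i j
      by_cases hij : i = j <;> simp [hij, M, mul_comm t]
    have hP : P ≠ 0 := by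
      intro h0
      have := heval 0
      simp [h0] at this
    refine (Polynomial.finite_setOfPred_isRoot hP).subset ?_
    intro t ht
    simpa [Polynomial.IsRoot, heval] using ht
  refine hfin.subset ?_
  intro t ht
  by_contra hdet
  have hcomp : q ∘ₗ (f + t • g) ∘ₗ p = LinearMap.id + t • h := by
    rw [← hid]
    ext x
    simp [h]
  have hu : IsUnit (LinearMap.id + t • h) :=
    (LinearMap.isUnit_iff_isUnit_det _).2 (isUnit_iff_ne_zero.2 hdet)
  have hsurj : Function.Surjective ⇑(LinearMap.id + t • h : Module.End K (LinearMap.range f)) :=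
    ((Module.End.isUnit_iff _).1 hu).2
  have hle : Module.finrank K (LinearMap.range f) ≤
      Module.finrank K (LinearMap.range (f + t • g)) := by
    refine LinearMap.finrank_le_finrank_of_surjective
      (f := q ∘ₗ (LinearMap.range (f + t • g)).subtype) ?_
    intro y
    obtain ⟨x, hx⟩ := hsurj y
    rw [← hcomp] at hx
    exact ⟨⟨(f + t • g) (p x), LinearMap.mem_range_self _ _⟩, hx⟩
  exact absurd ht (not_lt.2 hle)

variable {R : Type*} [CommRing R] [Algebra K R]

/-- The colon ideal `(J : a)`. -/
def colonElement (J : Ideal R) (a : R) : Ideal R :=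
  Submodule.comap (LinearMap.mulLeft R a) J

theorem mem_colonElement {J : Ideal R} {a x : R} : x ∈ colonElement J a ↔ a * x ∈ J :=
  Iff.rfl

theorem le_colonElement (J : Ideal R) (a : R) : J ≤ colonElement J a :=
  fun _ hx => J.mul_mem_left a hx

theorem finiteDimensional_quotient_of_le {J J' : Ideal R} (h : J ≤ J')
    [FiniteDimensional K (R ⧸ J)] : FiniteDimensional K (R ⧸ J') :=
  Module.Finite.of_surjective (Ideal.Quotient.factorₐ K h).toLinearMap
    (Ideal.Quotient.factor_surjective h)

theorem finrank_quotient_le_of_le {J J' : Ideal R} (h : J ≤ J')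
    [FiniteDimensional K (R ⧸ J)] :
    Module.finrank K (R ⧸ J') ≤ Module.finrank K (R ⧸ J) :=
  LinearMap.finrank_le_finrank_of_surjective (f := (Ideal.Quotient.factorₐ K h).toLinearMap)
    (Ideal.Quotient.factor_surjective h)

/-- Multiplication by the class of `a` on `R ⧸ J`. -/
noncomputable def quotientMul (K : Type*) [Field K] {R : Type*} [CommRing R] [Algebra K R]
    (J : Ideal R) : R →ₗ[K] (R ⧸ J) →ₗ[K] (R ⧸ J) :=
  LinearMap.mul K (R ⧸ J) ∘ₗ (Ideal.Quotient.mkₐ K J).toLinearMap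

theorem quotientMul_mk (J : Ideal R) (a x : R) :
    quotientMul K J a (Ideal.Quotient.mk J x) = Ideal.Quotient.mk J (a * x) := by
  simp [quotientMul]

theorem range_quotientMul (J : Ideal R) (a : R) :
    LinearMap.range (quotientMul K J a) =
      LinearMap.ker (Ideal.Quotient.factorₐ K
        (le_sup_left : J ≤ J ⊔ Ideal.span {a})).toLinearMap := by
  ext y
  obtain ⟨y, rfl⟩ := Ideal.Quotient.mk_surjective y
  have hker : Ideal.Quotient.mk J y ∈ LinearMap.ker (Ideal.Quotient.factorₐ K
        (le_sup_left : J ≤ J ⊔ Ideal.span {a})).toLinearMap ↔ y ∈ J ⊔ Ideal.span {a} := by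
    rw [← Ideal.Quotient.eq_zero_iff_mem]
    rfl
  rw [hker, sup_comm, Ideal.mem_span_singleton_sup]
  constructor
  · rintro ⟨x, hx⟩
    obtain ⟨x, rfl⟩ := Ideal.Quotient.mk_surjective x
    rw [quotientMul_mk, Ideal.Quotient.mk_eq_mk_iff_sub_mem] at hx
    exact ⟨x, y - a * x, by simpa using J.neg_mem hx, by ring⟩
  · rintro ⟨x, j, hj, rfl⟩
    refine ⟨Ideal.Quotient.mk J x, ?_⟩
    rw [quotientMul_mk, Ideal.Quotient.mk_eq_mk_iff_sub_mem]
    have : a * x - (x * a + j) = -j := by ring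
    rw [this]
    exact J.neg_mem hj

theorem finrank_range_quotientMul_add (J : Ideal R) [FiniteDimensional K (R ⧸ J)] (a : R) :
    Module.finrank K (LinearMap.range (quotientMul K J a)) +
      Module.finrank K (R ⧸ (J ⊔ Ideal.span {a})) = Module.finrank K (R ⧸ J) := by
  have hs : Function.Surjective (Ideal.Quotient.factorₐ K
      (le_sup_left : J ≤ J ⊔ Ideal.span {a})).toLinearMap :=
    Ideal.Quotient.factor_surjective le_sup_left
  rw [range_quotientMul, add_comm, ← LinearMap.finrank_range_add_finrank_ker
    (Ideal.Quotient.factorₐ K (le_sup_left : J ≤ J ⊔ Ideal.span {a})).toLinearMap,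
    LinearMap.range_eq_top.2 hs, finrank_top]

theorem finrank_range_quotientMul (J : Ideal R) [FiniteDimensional K (R ⧸ J)] (a : R) :
    Module.finrank K (LinearMap.range (quotientMul K J a)) =
      Module.finrank K (R ⧸ colonElement J a) := by
  have hs : Function.Surjective (Ideal.Quotient.factorₐ K (le_colonElement J a)).toLinearMap :=
    Ideal.Quotient.factor_surjective (le_colonElement J a)
  have hker : LinearMap.ker (quotientMul K J a) =
      LinearMap.ker (Ideal.Quotient.factorₐ K (le_colonElement J a)).toLinearMap := by
    ext y
    obtain ⟨y, rfl⟩ := Ideal.Quotient.mk_surjective y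
    rw [LinearMap.mem_ker, quotientMul_mk, Ideal.Quotient.eq_zero_iff_mem, ← mem_colonElement,
      ← Ideal.Quotient.eq_zero_iff_mem]
    rfl
  have h1 := LinearMap.finrank_range_add_finrank_ker (quotientMul K J a)
  have h2 := LinearMap.finrank_range_add_finrank_ker
    (Ideal.Quotient.factorₐ K (le_colonElement J a)).toLinearMap
  rw [LinearMap.range_eq_top.2 hs, finrank_top] at h2
  rw [hker] at h1
  omega

theorem finrank_quotient_colonElement_add (J : Ideal R) [FiniteDimensional K (R ⧸ J)] (a : R) :
    Module.finrank K (R ⧸ colonElement J a) +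
      Module.finrank K (R ⧸ (J ⊔ Ideal.span {a})) = Module.finrank K (R ⧸ J) := by
  rw [← finrank_range_quotientMul, finrank_range_quotientMul_add]

theorem finrank_quotient_sup_span_le (J : Ideal R) [FiniteDimensional K (R ⧸ J)] (a c : R) :
    Module.finrank K (R ⧸ (J ⊔ Ideal.span {c})) ≤
      Module.finrank K (R ⧸ (J ⊔ Ideal.span {a} ⊔ Ideal.span {c})) +
        Module.finrank K (R ⧸ (colonElement J a ⊔ Ideal.span {c})) := by
  have : FiniteDimensional K (R ⧸ (J ⊔ Ideal.span {c})) :=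
    finiteDimensional_quotient_of_le (le_sup_left : J ≤ _)
  have : FiniteDimensional K (R ⧸ (colonElement J a ⊔ Ideal.span {c})) :=
    finiteDimensional_quotient_of_le ((le_colonElement J a).trans le_sup_left)
  have h1 := finrank_quotient_colonElement_add (K := K) (J ⊔ Ideal.span {c}) a
  have hle : colonElement J a ⊔ Ideal.span {c} ≤ colonElement (J ⊔ Ideal.span {c}) a := by
    refine sup_le (fun x hx => Ideal.mem_sup_left (mem_colonElement.1 hx)) ?_
    exact le_sup_right.trans (le_colonElement _ a)
  have h2 := finrank_quotient_le_of_le (K := K) hle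
  rw [sup_right_comm] at h1
  omega

/-- Over an infinite field, a generic element of `E` cuts down two given cofinite ideals at least
as well as any two prescribed elements do. -/
theorem exists_mem_finrank_quotient_sup_le [Infinite K] (J₁ J₂ : Ideal R)
    [FiniteDimensional K (R ⧸ J₁)] [FiniteDimensional K (R ⧸ J₂)] (E : Submodule K R)
    {a₁ a₂ : R} (h₁ : a₁ ∈ E) (h₂ : a₂ ∈ E) :
    ∃ a ∈ E,
      Module.finrank K (R ⧸ (J₁ ⊔ Ideal.span {a})) ≤
        Module.finrank K (R ⧸ (J₁ ⊔ Ideal.span {a₁})) ∧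
      Module.finrank K (R ⧸ (J₂ ⊔ Ideal.span {a})) ≤
        Module.finrank K (R ⧸ (J₂ ⊔ Ideal.span {a₂})) := by
  have hF₁ := finite_setOf_finrank_range_add_smul_lt (quotientMul K J₁ a₁) (quotientMul K J₁ a₂)
  have hF₂ := finite_setOf_finrank_range_add_smul_lt (quotientMul K J₂ a₂) (quotientMul K J₂ a₁)
  obtain ⟨t, ht⟩ := ((hF₁.union (hF₂.image (·⁻¹))).union (Set.finite_singleton 0)).exists_notMem
  simp only [Set.mem_union, not_or, Set.mem_singleton_iff] at ht
  obtain ⟨⟨ht₁, ht₂⟩, ht0⟩ := ht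
  have ht₂' : Module.finrank K (LinearMap.range (quotientMul K J₂ a₂)) ≤ Module.finrank K
      (LinearMap.range (quotientMul K J₂ a₂ + t⁻¹ • quotientMul K J₂ a₁)) :=
    not_lt.1 fun h => ht₂ ⟨t⁻¹, h, inv_inv t⟩
  have ht₁' : Module.finrank K (LinearMap.range (quotientMul K J₁ a₁)) ≤ Module.finrank K
      (LinearMap.range (quotientMul K J₁ a₁ + t • quotientMul K J₁ a₂)) := not_lt.1 ht₁
  have hrange : LinearMap.range (quotientMul K J₂ a₂ + t⁻¹ • quotientMul K J₂ a₁) =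
      LinearMap.range (quotientMul K J₂ (a₁ + t • a₂)) := by
    rw [← LinearMap.range_smul (quotientMul K J₂ a₂ + t⁻¹ • quotientMul K J₂ a₁) t ht0]
    congr 1
    rw [smul_add, smul_smul, mul_inv_cancel₀ ht0, one_smul, map_add, map_smul, add_comm]
  rw [← map_smul, ← map_add] at ht₁'
  rw [hrange] at ht₂'
  refine ⟨a₁ + t • a₂, E.add_mem h₁ (E.smul_mem t h₂), ?_, ?_⟩
  · have h1 := finrank_range_quotientMul_add (K := K) J₁ a₁
    have h2 := finrank_range_quotientMul_add (K := K) J₁ (a₁ + t • a₂)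
    omega
  · have h1 := finrank_range_quotientMul_add (K := K) J₂ a₂
    have h2 := finrank_range_quotientMul_add (K := K) J₂ (a₁ + t • a₂)
    omega

/-- An element of `E` minimising `dim R ⧸ (J + (a))`, together with a complement of it in `E`. -/
theorem exists_minimal_mem_and_complement (J : Ideal R) [FiniteDimensional K (R ⧸ J)]
    (E : Submodule K R) [FiniteDimensional K E] {m : ℕ} (hE : Module.finrank K E ≤ m + 1) :
    ∃ a ∈ E, (∀ c ∈ E, Module.finrank K (R ⧸ (J ⊔ Ideal.span {a})) ≤
        Module.finrank K (R ⧸ (J ⊔ Ideal.span {c}))) ∧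
      ∃ E' ≤ E, E ≤ K ∙ a ⊔ E' ∧ Module.finrank K E' ≤ m := by
  obtain ⟨a, ha, hmin⟩ := exists_minimalFor_of_wellFoundedLT (· ∈ E)
    (fun a => Module.finrank K (R ⧸ (J ⊔ Ideal.span {a}))) ⟨0, E.zero_mem⟩
  replace hmin : ∀ c ∈ E, Module.finrank K (R ⧸ (J ⊔ Ideal.span {a})) ≤
      Module.finrank K (R ⧸ (J ⊔ Ideal.span {c})) := fun c hc =>
    (le_total _ _).elim id (hmin hc)
  rcases eq_or_ne E ⊥ with rfl | hE0
  · exact ⟨a, ha, hmin, ⊥, le_rfl, bot_le, by simp⟩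
  obtain ⟨a', ha', ha'0, hmin'⟩ : ∃ a' ∈ E, a' ≠ 0 ∧ ∀ c ∈ E,
      Module.finrank K (R ⧸ (J ⊔ Ideal.span {a'})) ≤
        Module.finrank K (R ⧸ (J ⊔ Ideal.span {c})) := by
    rcases eq_or_ne a 0 with rfl | ha0
    · obtain ⟨a', ha', ha'0⟩ := E.ne_bot_iff.1 hE0
      refine ⟨a', ha', ha'0, fun c hc => le_trans ?_ (hmin c hc)⟩
      have : FiniteDimensional K (R ⧸ (J ⊔ Ideal.span {(0 : R)})) :=
        finiteDimensional_quotient_of_le (le_sup_left : J ≤ _)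
      exact finrank_quotient_le_of_le (by simp)
    · exact ⟨a, ha, ha0, hmin⟩
  refine ⟨a', ha', hmin', ?_⟩
  obtain ⟨C, hC⟩ := Submodule.exists_isCompl (K ∙ (⟨a', ha'⟩ : E))
  have hrank := Submodule.finrank_add_eq_of_isCompl hC
  rw [finrank_span_singleton (by simpa [Subtype.ext_iff] using ha'0)] at hrank
  refine ⟨C.map E.subtype, Submodule.map_subtype_le _ _, ?_, ?_⟩
  · have h := congrArg (Submodule.map E.subtype) hC.sup_eq_top
    rw [Submodule.map_sup, Submodule.map_span, Submodule.map_subtype_top] at h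
    simpa using h.ge
  · have := Submodule.finrank_map_le E.subtype C
    omega

theorem sup_span_coe_le {E E' : Submodule K R} {a : R} (h : E ≤ K ∙ a ⊔ E') (J : Ideal R) :
    J ⊔ Ideal.span (E : Set R) ≤ J ⊔ Ideal.span {a} ⊔ Ideal.span (E' : Set R) := by
  refine sup_le (le_sup_left.trans le_sup_left) (Ideal.span_le.2 fun x hx => ?_)
  obtain ⟨y, hy, z, hz, rfl⟩ := Submodule.mem_sup.1 (h hx)
  obtain ⟨c, rfl⟩ := Submodule.mem_span_singleton.1 hy
  refine Ideal.add_mem _ (Ideal.mem_sup_left (Ideal.mem_sup_right ?_))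
    (Ideal.mem_sup_right (Ideal.subset_span hz))
  rw [Algebra.smul_def]
  exact Ideal.mul_mem_left _ _ (Ideal.mem_span_singleton_self a)

/-- If `a` is optimal for `J`, the gain by cutting `R ⧸ (J + (a))` once more is at most the
dimension of any section of `R ⧸ (J : a)`. -/
theorem finrank_sub_le_of_minimal [Infinite K] (J : Ideal R) [FiniteDimensional K (R ⧸ J)]
    {E : Submodule K R} {a a₁ a₂ : R} (h₁ : a₁ ∈ E) (h₂ : a₂ ∈ E)
    (hmin : ∀ c ∈ E, Module.finrank K (R ⧸ (J ⊔ Ideal.span {a})) ≤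
      Module.finrank K (R ⧸ (J ⊔ Ideal.span {c}))) :
    Module.finrank K (R ⧸ (J ⊔ Ideal.span {a})) ≤
      Module.finrank K (R ⧸ (J ⊔ Ideal.span {a} ⊔ Ideal.span {a₁})) +
        Module.finrank K (R ⧸ (colonElement J a ⊔ Ideal.span {a₂})) := by
  have : FiniteDimensional K (R ⧸ (J ⊔ Ideal.span {a})) :=
    finiteDimensional_quotient_of_le (le_sup_left : J ≤ _)
  have : FiniteDimensional K (R ⧸ colonElement J a) :=
    finiteDimensional_quotient_of_le (le_colonElement J a)
  obtain ⟨c, hc, hc₁, hc₂⟩ := exists_mem_finrank_quotient_sup_le (K := K)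
    (J ⊔ Ideal.span {a}) (colonElement J a) E h₁ h₂
  have h := finrank_quotient_sup_span_le (K := K) J a c
  have h' := hmin c hc
  omega

/-- Multiplication by some element of an `m`-dimensional generating space has rank at least
`binom(b, m)` as soon as the quotient has dimension at least `binom(b + 1, m)`. -/
def HasLargeMultiplicationRank (K R : Type*) [Field K] [CommRing R] [Algebra K R] (m : ℕ) :
    Prop :=
  ∀ (J : Ideal R) [FiniteDimensional K (R ⧸ J)] (E : Submodule K R) [FiniteDimensional K E],
    Module.finrank K E ≤ m → Module.finrank K (R ⧸ (J ⊔ Ideal.span (E : Set R))) ≤ 1 →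
    ∀ b : ℕ, (b + 1).choose m ≤ Module.finrank K (R ⧸ J) →
      ∃ a ∈ E, b.choose m + Module.finrank K (R ⧸ (J ⊔ Ideal.span {a})) ≤
        Module.finrank K (R ⧸ J)

/-- Some element of an `(m + 1)`-dimensional generating space cuts the quotient down to dimension
less than `binom(b, m)` as soon as it has dimension less than `binom(b + 1, m + 1)`. -/
def HasSmallSection (K R : Type*) [Field K] [CommRing R] [Algebra K R] (m : ℕ) : Prop :=
  ∀ (b : ℕ) (J : Ideal R) [FiniteDimensional K (R ⧸ J)] (E : Submodule K R)
    [FiniteDimensional K E], Module.finrank K E ≤ m + 1 →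
    Module.finrank K (R ⧸ (J ⊔ Ideal.span (E : Set R))) ≤ 1 →
    Module.finrank K (R ⧸ J) < (b + 1).choose (m + 1) →
      ∃ a ∈ E, Module.finrank K (R ⧸ (J ⊔ Ideal.span {a})) < b.choose m

theorem hasLargeMultiplicationRank_one : HasLargeMultiplicationRank K R 1 := by
  intro J _ E _ hE hgen b hb
  obtain ⟨a, ha, -, E', hE'E, hle, hE'⟩ := exists_minimal_mem_and_complement J E hE
  refine ⟨a, ha, ?_⟩
  obtain rfl : E' = ⊥ := by
    have : FiniteDimensional K E' := Submodule.finiteDimensional_of_le hE'E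
    exact Submodule.finrank_eq_zero.1 (Nat.le_zero.1 hE')
  have : FiniteDimensional K (R ⧸ (J ⊔ Ideal.span (E : Set R))) :=
    finiteDimensional_quotient_of_le (le_sup_left : J ≤ _)
  have h := finrank_quotient_le_of_le (K := K) (sup_span_coe_le hle J)
  have hbot : Ideal.span (((⊥ : Submodule K R) : Set R)) = ⊥ := by simp
  rw [hbot, sup_bot_eq] at h
  simp only [Nat.choose_one_right] at hb ⊢
  omega

theorem HasLargeMultiplicationRank.hasSmallSection [Infinite K] {m : ℕ} (hm : 1 ≤ m)
    (hQ : HasLargeMultiplicationRank K R m) : HasSmallSection K R m := by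
  intro b
  induction b with
  | zero =>
    intro J _ E _ _ _ hJ
    rw [Nat.choose_eq_zero_of_lt (by omega)] at hJ
    exact absurd hJ (Nat.not_lt_zero _)
  | succ b ih =>
    intro J _ E _ hE hgen hJ
    obtain ⟨a, ha, hmin, E', hE'E, hle, hE'⟩ := exists_minimal_mem_and_complement J E hE
    refine ⟨a, ha, ?_⟩
    by_contra! hlarge
    have : FiniteDimensional K (R ⧸ (J ⊔ Ideal.span {a})) :=
      finiteDimensional_quotient_of_le (le_sup_left : J ≤ _)
    have : FiniteDimensional K (R ⧸ colonElement J a) :=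
      finiteDimensional_quotient_of_le (le_colonElement J a)
    have : FiniteDimensional K (R ⧸ (J ⊔ Ideal.span (E : Set R))) :=
      finiteDimensional_quotient_of_le (le_sup_left : J ≤ _)
    have : FiniteDimensional K E' := Submodule.finiteDimensional_of_le hE'E
    have hadd := finrank_quotient_colonElement_add (K := K) J a
    have hpascal := Nat.choose_succ_succ' (b + 1) m
    obtain ⟨a₂, ha₂, hlt⟩ := ih (colonElement J a) E hE
      ((finrank_quotient_le_of_le (sup_le_sup_right (le_colonElement J a) _)).trans hgen)
      (by omega)
    obtain ⟨a₁, ha₁, hge⟩ := hQ (J ⊔ Ideal.span {a}) E' hE'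
      ((finrank_quotient_le_of_le (sup_span_coe_le hle J)).trans hgen) b hlarge
    have := finrank_sub_le_of_minimal J (hE'E ha₁) ha₂ hmin
    omega

theorem HasLargeMultiplicationRank.succ [Infinite K] {m : ℕ}
    (hQ : HasLargeMultiplicationRank K R m) (hP : HasSmallSection K R m) :
    HasLargeMultiplicationRank K R (m + 1) := by
  intro J _ E _ hE hgen b hJ
  obtain ⟨a, ha, hmin, E', hE'E, hle, hE'⟩ := exists_minimal_mem_and_complement J E hE
  refine ⟨a, ha, ?_⟩
  by_contra! hsmall
  have : FiniteDimensional K (R ⧸ (J ⊔ Ideal.span {a})) :=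
    finiteDimensional_quotient_of_le (le_sup_left : J ≤ _)
  have : FiniteDimensional K (R ⧸ colonElement J a) :=
    finiteDimensional_quotient_of_le (le_colonElement J a)
  have : FiniteDimensional K (R ⧸ (J ⊔ Ideal.span (E : Set R))) :=
    finiteDimensional_quotient_of_le (le_sup_left : J ≤ _)
  have : FiniteDimensional K E' := Submodule.finiteDimensional_of_le hE'E
  have hadd := finrank_quotient_colonElement_add (K := K) J a
  cases b with
  | zero =>
    rw [Nat.choose_eq_zero_of_lt (by omega)] at hsmall
    omega
  | succ b =>
    have hpascal := Nat.choose_succ_succ' (b + 1) m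
    obtain ⟨a₂, ha₂, hlt⟩ := hP b (colonElement J a) E hE
      ((finrank_quotient_le_of_le (sup_le_sup_right (le_colonElement J a) _)).trans hgen)
      (by omega)
    obtain ⟨a₁, ha₁, hge⟩ := hQ (J ⊔ Ideal.span {a}) E' hE'
      ((finrank_quotient_le_of_le (sup_span_coe_le hle J)).trans hgen) b (by omega)
    have := finrank_sub_le_of_minimal J (hE'E ha₁) ha₂ hmin
    omega

theorem hasSmallSection [Infinite K] {m : ℕ} (hm : 1 ≤ m) : HasSmallSection K R m := by
  refine HasLargeMultiplicationRank.hasSmallSection hm ?_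
  induction m, hm using Nat.le_induction with
  | base => exact hasLargeMultiplicationRank_one
  | succ m hm ih => exact ih.succ (ih.hasSmallSection hm)

end CofiniteIdeals

section LinearForms

variable {𝕜 : Type} [Field 𝕜] {n : ℕ}

/-- The linear form in `𝕜[x₁, …, xₙ]` attached to a functional on `𝕜ⁿ`. -/
noncomputable def linearFormOfDual (𝕜 : Type) [Field 𝕜] (n : ℕ) :
    Module.Dual 𝕜 (Fin n → 𝕜) →ₗ[𝕜] MvPolynomial (Fin n) 𝕜 :=
  ∑ i, (LinearMap.toSpanSingleton 𝕜 _ (X i)) ∘ₗ LinearMap.applyₗ (Pi.single i 1)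

theorem linearFormOfDual_apply (φ : Module.Dual 𝕜 (Fin n → 𝕜)) :
    linearFormOfDual 𝕜 n φ = ∑ i, φ (Pi.single i 1) • (X i : MvPolynomial (Fin n) 𝕜) := by
  simp [linearFormOfDual]

theorem linearFormOfDual_proj (i : Fin n) :
    linearFormOfDual 𝕜 n (LinearMap.proj i) = X i := by
  rw [linearFormOfDual_apply, Finset.sum_eq_single i] <;>
    simp +contextual [eq_comm]

theorem eval_linearFormOfDual (φ : Module.Dual 𝕜 (Fin n → 𝕜)) (x : Fin n → 𝕜) :
    eval x (linearFormOfDual 𝕜 n φ) = φ x := by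
  have hsingle : ∀ i : Fin n, (fun j => if i = j then (1 : 𝕜) else 0) = Pi.single i 1 := by
    intro i
    ext j
    simp [Pi.single_apply, eq_comm]
  rw [linearFormOfDual_apply, LinearMap.pi_apply_eq_sum_univ φ x]
  simp [smul_eval, mul_comm, hsingle]

theorem isHomogeneous_linearFormOfDual (φ : Module.Dual 𝕜 (Fin n → 𝕜)) :
    (linearFormOfDual 𝕜 n φ).IsHomogeneous 1 := by
  rw [linearFormOfDual_apply]
  refine IsHomogeneous.sum _ _ _ fun i _ => ?_
  rw [smul_eq_C_mul]
  exact isHomogeneous_C_mul_X _ _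

theorem linearFormOfDual_mem {V : Submodule 𝕜 (Fin n → 𝕜)} {φ : Module.Dual 𝕜 (Fin n → 𝕜)}
    (h : ∀ x ∈ V, φ x = 0) : linearFormOfDual 𝕜 n φ ∈ linearSubspaceIdeal 𝕜 n V :=
  Ideal.subset_span ⟨isHomogeneous_linearFormOfDual φ, fun x hx => by
    rw [eval_linearFormOfDual, h x hx]⟩

theorem linearSubspaceIdeal_anti {V W : Submodule 𝕜 (Fin n → 𝕜)} (h : V ≤ W) :
    linearSubspaceIdeal 𝕜 n W ≤ linearSubspaceIdeal 𝕜 n V :=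
  Ideal.span_mono fun _ hf => ⟨hf.1, fun x hx => hf.2 x (h hx)⟩

theorem finrank_quotient_le_one_of_X_mem {J : Ideal (MvPolynomial (Fin n) 𝕜)}
    (h : ∀ i, X i ∈ J) : Module.finrank 𝕜 (MvPolynomial (Fin n) 𝕜 ⧸ J) ≤ 1 := by
  refine finrank_le_one 1 fun w => ?_
  obtain ⟨p, rfl⟩ := Ideal.Quotient.mk_surjective w
  induction p using MvPolynomial.induction_on with
  | C c => exact ⟨c, by rw [← map_one (Ideal.Quotient.mk J), ← Ideal.Quotient.mkₐ_eq_mk 𝕜,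
      ← map_smul, smul_eq_C_mul, mul_one]⟩
  | add p q hp hq =>
    obtain ⟨c, hc⟩ := hp
    obtain ⟨d, hd⟩ := hq
    exact ⟨c + d, by rw [add_smul, hc, hd, map_add]⟩
  | mul_X p i _ =>
    exact ⟨0, by rw [zero_smul, eq_comm, Ideal.Quotient.eq_zero_iff_mem]
                 exact J.mul_mem_left p (h i)⟩

/-- A complement of the linear forms vanishing on `W`. -/
theorem exists_generating_linearForms (W : Submodule 𝕜 (Fin n → 𝕜)) :
    ∃ C : Submodule 𝕜 (Module.Dual 𝕜 (Fin n → 𝕜)), Module.finrank 𝕜 C = Module.finrank 𝕜 W ∧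
      ∀ i, X i ∈ linearSubspaceIdeal 𝕜 n W ⊔
        Ideal.span (C.map (linearFormOfDual 𝕜 n) : Set (MvPolynomial (Fin n) 𝕜)) := by
  obtain ⟨C, hC⟩ := Submodule.exists_isCompl W.dualAnnihilator
  refine ⟨C, ?_, fun i => ?_⟩
  · have h1 := Submodule.finrank_add_eq_of_isCompl hC
    have h2 := Subspace.finrank_add_finrank_dualAnnihilator_eq W
    rw [Subspace.dual_finrank_eq] at h1
    omega
  · have hi : LinearMap.proj i ∈ W.dualAnnihilator ⊔ C := by
      rw [hC.sup_eq_top]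
      trivial
    obtain ⟨u, hu, c, hc, huc⟩ := Submodule.mem_sup.1 hi
    rw [← linearFormOfDual_proj (𝕜 := 𝕜) i, ← huc, map_add]
    exact Ideal.add_mem _
      (Ideal.mem_sup_left (linearFormOfDual_mem ((Submodule.mem_dualAnnihilator u).1 hu)))
      (Ideal.mem_sup_right (Ideal.subset_span (Submodule.mem_map_of_mem hc)))

theorem exists_le_finrank_eq {V : Type*} [AddCommGroup V] [Module 𝕜 V] [FiniteDimensional 𝕜 V]
    (U : Submodule 𝕜 V) {k : ℕ} (hk : k ≤ Module.finrank 𝕜 U) :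
    ∃ U' ≤ U, Module.finrank 𝕜 U' = k := by
  obtain ⟨f, hf⟩ := exists_linearIndependent_of_le_finrank hk
  refine ⟨(Submodule.span 𝕜 (Set.range f)).map U.subtype, Submodule.map_subtype_le _ _, ?_⟩
  rw [Submodule.finrank_map_subtype_eq, finrank_span_eq_card hf, Fintype.card_fin]

theorem finrank_le_finrank_inf_ker_add_one {V : Type*} [AddCommGroup V] [Module 𝕜 V]
    [FiniteDimensional 𝕜 V] (W : Submodule 𝕜 V) (φ : Module.Dual 𝕜 V) :
    Module.finrank 𝕜 W ≤ Module.finrank 𝕜 (W ⊓ LinearMap.ker φ : Submodule 𝕜 V) + 1 := by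
  have h1 := Submodule.finrank_sup_add_finrank_inf_eq W (LinearMap.ker φ)
  have h2 := LinearMap.finrank_range_add_finrank_ker φ
  have h3 := Submodule.finrank_le (LinearMap.range φ)
  have h4 := Submodule.finrank_le (W ⊔ LinearMap.ker φ)
  rw [Module.finrank_self] at h3
  omega

/-- Richness of all `k`-dimensional directions propagates to all larger directions. -/
theorem choose_le_finrank_of_all_directions_rich [Infinite 𝕜] {k b : ℕ} (hk : 1 ≤ k)
    (I : Ideal (MvPolynomial (Fin n) 𝕜)) [FiniteDimensional 𝕜 (MvPolynomial (Fin n) 𝕜 ⧸ I)]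
    (hrich : ∀ V : Submodule 𝕜 (Fin n → 𝕜), Module.finrank 𝕜 V = k →
      Nat.choose b k ≤
        Module.finrank 𝕜 (MvPolynomial (Fin n) 𝕜 ⧸ (I + linearSubspaceIdeal 𝕜 n V)))
    (j : ℕ) (W : Submodule 𝕜 (Fin n → 𝕜)) (hW : Module.finrank 𝕜 W = k + j) :
    Nat.choose (b + j) (k + j) ≤
      Module.finrank 𝕜 (MvPolynomial (Fin n) 𝕜 ⧸ (I + linearSubspaceIdeal 𝕜 n W)) := by
  induction j generalizing W with
  | zero => exact hrich W hW
  | succ j ih =>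
    by_contra! hlt
    obtain ⟨C, hC, hX⟩ := exists_generating_linearForms W
    have : FiniteDimensional 𝕜 (MvPolynomial (Fin n) 𝕜 ⧸ (I + linearSubspaceIdeal 𝕜 n W)) :=
      finiteDimensional_quotient_of_le (le_sup_left : I ≤ _)
    obtain ⟨a, ha, hsec⟩ := hasSmallSection (K := 𝕜) (m := k + j) (by omega) (b + j)
      (I + linearSubspaceIdeal 𝕜 n W) (C.map (linearFormOfDual 𝕜 n))
      ((Submodule.finrank_map_le _ C).trans (by omega))
      (finrank_quotient_le_one_of_X_mem fun i =>
        (sup_le_sup_right (le_sup_right : _ ≤ I ⊔ _) _) (hX i)) hlt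
    obtain ⟨φ, -, rfl⟩ := Submodule.mem_map.1 ha
    have hinf := finrank_le_finrank_inf_ker_add_one W φ
    obtain ⟨V, hV, hVk⟩ := exists_le_finrank_eq (W ⊓ LinearMap.ker φ)
      (k := k + j) (by omega)
    have hle : (I + linearSubspaceIdeal 𝕜 n W) ⊔ Ideal.span {linearFormOfDual 𝕜 n φ} ≤
        I + linearSubspaceIdeal 𝕜 n V := by
      refine sup_le (sup_le_sup_left (linearSubspaceIdeal_anti (hV.trans inf_le_left)) I) ?_
      rw [Ideal.span_singleton_le_iff_mem]
      exact Ideal.mem_sup_right (linearFormOfDual_mem fun x hx => (hV hx).2)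
    have : FiniteDimensional 𝕜 (MvPolynomial (Fin n) 𝕜 ⧸
        ((I + linearSubspaceIdeal 𝕜 n W) ⊔ Ideal.span {linearFormOfDual 𝕜 n φ})) :=
      finiteDimensional_quotient_of_le (le_sup_left : I + linearSubspaceIdeal 𝕜 n W ≤ _)
    exact absurd ((ih V hVk).trans (finrank_quotient_le_of_le hle)) (not_le.2 hsec)

end LinearForms

/-- **Proposition 5.1** (`X_{m,k}^S = Gr(k,n)` forces `S` large): if every
`k`-dimensional direction is `binom(b,k)`-rich for the homogeneous 0-dimensional
scheme defined by `I`, then `|S| ≥ binom(b+(n-k), n)`. -/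
theorem card_lower_bound_of_all_directions_rich
    (𝕜 : Type) [Field 𝕜] [IsAlgClosed 𝕜] (n k b : ℕ)
    (hn : 1 ≤ n) (hk1 : 1 ≤ k) (hkn : k ≤ n)
    (I : Ideal (MvPolynomial (Fin n) 𝕜))
    (hI : IsHomogeneousIdeal I)
    (hfin : FiniteDimensional 𝕜 (MvPolynomial (Fin n) 𝕜 ⧸ I))
    (hrich : ∀ V : Submodule 𝕜 (Fin n → 𝕜), Module.finrank 𝕜 V = k →
      Nat.choose b k ≤
        Module.finrank 𝕜 (MvPolynomial (Fin n) 𝕜 ⧸ (I + linearSubspaceIdeal 𝕜 n V))) :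
    Nat.choose (b + (n - k)) n ≤ Module.finrank 𝕜 (MvPolynomial (Fin n) 𝕜 ⧸ I) := by
  have h := choose_le_finrank_of_all_directions_rich hk1 I hrich (n - k) ⊤
    (by rw [finrank_top, Module.finrank_fin_fun]; omega)
  rw [Nat.add_sub_cancel' hkn] at h
  exact h.trans (finrank_quotient_le_of_le (le_sup_left : I ≤ I ⊔ _))
end

section
/- Fix integers n and k with 1 ≤ k ≤ n − 1. There is a constant C₂ > 0, depending only on n and k, with the following property. Let 𝕜 be an algebraically closed field, let I ⊆ 𝕜[x₁,…,xₙ] be a homogeneous ideal with N := dim_𝕜 𝕜[x₁,…,xₙ]/I finite, and let m ≥ 1 be an integer. Suppose there exists a k-dimensional linear subspace V₀ of 𝕜ⁿ with dim_𝕜 𝕜[x₁,…,xₙ]/(I + I_{V₀}) < m. Then there exists a nonzero homogeneous polynomial P, in variables indexed by the k-element subsets of {1,…,n}, of total degree at most C₂·N/m, such that for every k-dimensional linear subspace V of 𝕜ⁿ with dim_𝕜 𝕜[x₁,…,xₙ]/(I + I_V) ≥ 2m and every k×n matrix M over 𝕜 whose rows form a basis of V, the polynomial P vanishes at the Plücker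 coordinate vector of M, whose coordinate indexed by a k-element subset s ⊆ {1,…,n} is the determinant of the k×k submatrix of M formed by the columns in s. -/
open MvPolynomial

/-- The Plücker coordinate vector of a `k × n` matrix `M`: the coordinate indexed
by a `k`-element subset `s ⊆ {1,…,n}` is the determinant of the `k × k` submatrix
of `M` formed by the columns in `s` (in increasing order). -/
noncomputable def pluckerCoords {𝕜 : Type} [Field 𝕜] {n k : ℕ}
    (M : Matrix (Fin k) (Fin n) 𝕜) :
    {s : Finset (Fin n) // s.card = k} → 𝕜 :=
  fun s => (Matrix.of fun (i j : Fin k) => M i ((s.1.orderIsoOfFin s.2 j : Fin n))).det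

section PowComponent

variable {σ R : Type*} [CommRing R]

/-- The `X ^ a`-component of `F` over the subring of `q`-th powers of the variables, with
`X ^ q` renamed to `X`: the coefficient of `X ^ b` is that of `X ^ (q b + a)` in `F`. -/
noncomputable def powComponent (q : ℕ) (a : σ →₀ ℕ) (F : MvPolynomial σ R) : MvPolynomial σ R := by
  classical
  exact ∑ d ∈ F.support with d.mapRange (· % q) (Nat.zero_mod q) = a,
    monomial (d.mapRange (· / q) (Nat.zero_div q)) (coeff d F)

lemma coeff_powComponent {q : ℕ} {a : σ →₀ ℕ} (ha : ∀ i, a i < q) (F : MvPolynomial σ R)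
    (b : σ →₀ ℕ) : coeff b (powComponent q a F) = coeff (q • b + a) F := by
  classical
  have hmod : (q • b + a).mapRange (· % q) (Nat.zero_mod q) = a := by
    ext i; simp [Nat.mod_eq_of_lt (ha i)]
  have hdiv : (q • b + a).mapRange (· / q) (Nat.zero_div q) = b := by
    ext i
    have := (Nat.zero_le _).trans_lt (ha i)
    simp [Nat.mul_add_div this, Nat.div_eq_of_lt (ha i)]
  rw [powComponent, coeff_sum, Finset.sum_eq_single (q • b + a)]
  · rw [hdiv, coeff_monomial, if_pos rfl]
  · intro d hd hne
    rw [coeff_monomial, if_neg]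
    rintro rfl
    apply hne
    have h := (Finset.mem_filter.1 hd).2
    ext i
    have := DFunLike.congr_fun h i
    simp only [Finsupp.mapRange_apply] at this
    simp [← this, Nat.div_add_mod]
  · intro h
    simp only [Finset.mem_filter, hmod, and_true, notMem_support_iff] at h
    simp [h]

lemma powComponent_mul_X_pow {q : ℕ} {a : σ →₀ ℕ} (ha : ∀ i, a i < q)
    (F : MvPolynomial σ R) (i : σ) :
    powComponent q a (F * X i ^ q) = powComponent q a F * X i := by
  classical
  ext b
  rw [coeff_powComponent ha, X_pow_eq_monomial, X, coeff_mul_monomial', coeff_mul_monomial']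
  have hq := (Nat.zero_le _).trans_lt (ha i)
  have hiff : Finsupp.single i q ≤ q • b + a ↔ Finsupp.single i 1 ≤ b := by
    simp only [Finsupp.single_le_iff, Finsupp.add_apply, Finsupp.smul_apply, smul_eq_mul]
    constructor
    · intro h
      by_contra hb
      have hb0 : b i = 0 := by omega
      rw [hb0, mul_zero, zero_add] at h
      exact absurd (ha i) h.not_gt
    · intro h
      nlinarith
  by_cases h : Finsupp.single i 1 ≤ b
  · rw [if_pos h, if_pos (hiff.2 h), coeff_powComponent ha]
    congr 2
    obtain ⟨c, rfl⟩ := le_iff_exists_add.1 h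
    have : q • (Finsupp.single i 1 + c) + a = Finsupp.single i q + (q • c + a) := by
      rw [smul_add, Finsupp.smul_single, smul_eq_mul, mul_one, add_assoc]
    rw [this, add_tsub_cancel_left, add_tsub_cancel_left]
  · rw [if_neg h, if_neg (mt hiff.1 h)]

lemma eval_powComponent_eq_zero {q : ℕ} {a : σ →₀ ℕ} (ha : ∀ i, a i < q) {F : MvPolynomial σ R}
    {z : σ → R}
    (hF : F ∈ Ideal.span (Set.range fun i => (X i ^ q - C (z i) : MvPolynomial σ R))) :
    eval z (powComponent q a F) = 0 := by
  have hadd (G H : MvPolynomial σ R) :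
      powComponent q a (G + H) = powComponent q a G + powComponent q a H := by
    ext b; simp [coeff_powComponent ha]
  have hC (G : MvPolynomial σ R) (c : R) :
      powComponent q a (G * C c) = powComponent q a G * C c := by
    ext b; rw [mul_comm, mul_comm _ (C c)]; simp [coeff_powComponent ha, coeff_C_mul]
  have hzero : powComponent q a (0 : MvPolynomial σ R) = 0 := by
    ext b; simp [coeff_powComponent ha]
  have hsub (G H : MvPolynomial σ R) :
      powComponent q a (G - H) = powComponent q a G - powComponent q a H := by
    rw [eq_sub_iff_add_eq, ← hadd, sub_add_cancel]
  induction hF using Submodule.closure_induction with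
  | zero => simp [hzero]
  | add G H _ _ hG hH => simp [hadd, hG, hH]
  | smul_mem r x hx =>
    obtain ⟨i, rfl⟩ := hx
    simp [mul_sub, hsub, hC, powComponent_mul_X_pow ha]

lemma totalDegree_powComponent_le {q : ℕ} {a : σ →₀ ℕ} (ha : ∀ i, a i < q)
    (F : MvPolynomial σ R) : q * (powComponent q a F).totalDegree ≤ F.totalDegree := by
  by_cases h0 : powComponent q a F = 0
  · simp [h0]
  obtain ⟨b, hb, hbd⟩ := Finset.exists_mem_eq_sup _ (support_nonempty.2 h0)
    fun s => s.sum fun _ e => e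
  rw [totalDegree, hbd]
  rw [mem_support_iff, coeff_powComponent ha] at hb
  refine le_trans ?_ (le_totalDegree (mem_support_iff.2 hb))
  change q * b.degree ≤ (q • b + a).degree
  simp

lemma exists_powComponent_ne_zero {q : ℕ} (hq : 0 < q) {F : MvPolynomial σ R} (hF : F ≠ 0) :
    ∃ a : σ →₀ ℕ, (∀ i, a i < q) ∧ powComponent q a F ≠ 0 := by
  obtain ⟨d, hd⟩ := ne_zero_iff.1 hF
  have ha : ∀ i, d.mapRange (· % q) (Nat.zero_mod q) i < q := fun i => by
    simpa using Nat.mod_lt _ hq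
  refine ⟨_, ha, ne_zero_iff.2 ⟨d.mapRange (· / q) (Nat.zero_div q), ?_⟩⟩
  rw [coeff_powComponent ha]
  convert hd
  ext i
  simp [Nat.div_add_mod]

end PowComponent

/-- The order of vanishing of `F` at `z` is at least `m`. -/
def VanishesToOrder {σ R : Type*} [CommRing R] (F : MvPolynomial σ R) (z : σ → R) (m : ℕ) : Prop :=
  aeval (fun i => X i + C (z i)) F ∈ idealOfVars σ R ^ m

section VanishesToOrder

variable {σ R : Type*} [CommRing R]

lemma VanishesToOrder.pow {F : MvPolynomial σ R} {z : σ → R} {m : ℕ}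
    (h : VanishesToOrder F z m) (j : ℕ) : VanishesToOrder (F ^ j) z (m * j) := by
  rw [VanishesToOrder, map_pow, pow_mul]
  exact Ideal.pow_mem_pow h j

lemma VanishesToOrder.mono {F : MvPolynomial σ R} {z : σ → R} {m n : ℕ}
    (h : VanishesToOrder F z m) (hn : n ≤ m) : VanishesToOrder F z n :=
  Ideal.pow_le_pow_right hn h

lemma vanishesToOrder_map_iff {S : Type*} [CommRing S] {f : R →+* S} (F : MvPolynomial σ R)
    (z : σ → R) (m : ℕ) : VanishesToOrder (map f F) (f ∘ z) m ↔
      map f (aeval (fun i => X i + C (z i)) F) ∈ idealOfVars σ S ^ m := by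
  have : (map f).comp (aeval (R := R) (fun i => (X i + C (z i) : MvPolynomial σ R))).toRingHom =
      (aeval (R := S) (fun i => (X i + C (f (z i)) : MvPolynomial σ S))).toRingHom.comp (map f) := by
    ext i <;> simp
  rw [VanishesToOrder]
  exact iff_of_eq (congrArg (· ∈ _) (RingHom.congr_fun this F).symm)

lemma VanishesToOrder.map {S : Type*} [CommRing S] (f : R →+* S) {F : MvPolynomial σ R}
    {z : σ → R} {m : ℕ} (h : VanishesToOrder F z m) :
    VanishesToOrder (MvPolynomial.map f F) (f ∘ z) m := by
  rw [vanishesToOrder_map_iff]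
  rw [VanishesToOrder, mem_pow_idealOfVars_iff'] at h
  rw [mem_pow_idealOfVars_iff']
  intro x hx
  rw [coeff_map, h x hx, map_zero]

lemma VanishesToOrder.of_map {S : Type*} [CommRing S] {f : R →+* S} (hf : Function.Injective f)
    {F : MvPolynomial σ R} {z : σ → R} {m : ℕ}
    (h : VanishesToOrder (MvPolynomial.map f F) (f ∘ z) m) : VanishesToOrder F z m := by
  rw [vanishesToOrder_map_iff, mem_pow_idealOfVars_iff'] at h
  rw [VanishesToOrder, mem_pow_idealOfVars_iff']
  intro x hx
  apply hf
  rw [← coeff_map, h x hx, map_zero]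

/-- Vanishing to high order implies membership in the Frobenius power of the maximal ideal. -/
lemma VanishesToOrder.mem_span_pow [Fintype σ] {p e : ℕ} [Fact p.Prime] [CharP R p]
    {F : MvPolynomial σ R} {z : σ → R}
    (h : VanishesToOrder F z (Fintype.card σ * p ^ e + 1)) :
    F ∈ Ideal.span (Set.range fun i =>
      (X i ^ p ^ e - C (z i ^ p ^ e) : MvPolynomial σ R)) := by
  set G := aeval (fun i => (X i + C (z i) : MvPolynomial σ R)) F with hG
  have hFG : F = aeval (fun i => (X i - C (z i) : MvPolynomial σ R)) G := by
    have : (aeval (fun i => (X i - C (z i) : MvPolynomial σ R))).comp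
        (aeval (fun i => (X i + C (z i) : MvPolynomial σ R))) = AlgHom.id R _ := by
      ext i; simp [← algebraMap_eq]
    exact (AlgHom.congr_fun this F).symm
  have hmem : G ∈ Ideal.span (Set.range fun i => (X i ^ p ^ e : MvPolynomial σ R)) := by
    rw [G.as_sum]
    refine Ideal.sum_mem _ fun d hd => ?_
    have hdeg := (mem_pow_idealOfVars_iff _ _).1 h d hd
    obtain ⟨i, hi⟩ : ∃ i, p ^ e ≤ d i := by
      by_contra! hlt
      rw [Finsupp.degree_eq_sum] at hdeg
      have := Finset.sum_le_sum fun i (_ : i ∈ Finset.univ) => (hlt i).le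
      simp only [Finset.sum_const, Finset.card_univ, smul_eq_mul] at this
      omega
    have : monomial d (coeff d G) =
        monomial (d - Finsupp.single i (p ^ e)) (coeff d G) * X i ^ p ^ e := by
      rw [X_pow_eq_monomial, monomial_mul, mul_one, tsub_add_cancel_of_le]
      simpa using hi
    rw [this]
    exact Ideal.mul_mem_left _ _ (Ideal.subset_span ⟨i, rfl⟩)
  have := Ideal.mem_map_of_mem
    (aeval (R := R) (fun i => (X i - C (z i) : MvPolynomial σ R))).toRingHom hmem
  rw [Ideal.map_span, ← Set.range_comp] at this
  rw [hFG]
  convert this using 4 with i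
  · simp [sub_pow_char_pow]
  · rfl

end VanishesToOrder

instance Int.isJacobsonRing : IsJacobsonRing ℤ := by
  rw [isJacobsonRing_iff_prime_eq]
  intro P hP
  by_cases hbot : P = ⊥
  · subst hbot
    refine le_antisymm (fun x hx => ?_) Ideal.le_jacobson
    have h := Ideal.mem_jacobson_bot.1 hx x
    rw [Int.isUnit_iff] at h
    rw [Ideal.mem_bot]
    rcases h with h | h <;> nlinarith [sq_nonneg x]
  · have := IsPrime.to_maximal_ideal (hpi := hP) hbot
    exact Ideal.jacobson_eq_self_of_isMaximal

/-- A field that is finitely generated as a ring has positive characteristic. -/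
lemma exists_prime_charP_of_finiteType_int (κ : Type*) [Field κ]
    (h : (Int.castRingHom κ).FiniteType) :
    ∃ p : ℕ, p.Prime ∧ CharP κ p := by
  obtain ⟨p, hp⟩ := CharP.exists κ
  rcases CharP.char_is_prime_or_zero κ p with h | rfl
  · exact ⟨p, h, hp⟩
  · have := CharP.charP_to_charZero κ
    let := (Int.castRingHom κ).toAlgebra
    have : Algebra.FiniteType ℤ κ := h
    have := finite_of_finite_type_of_isJacobsonRing ℤ κ
    have hf : IsField ℤ := isField_of_isIntegral_of_isField
      (Int.cast_injective (α := κ)) (Field.toIsField κ)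
    exact absurd hf Int.not_isField

universe u in
/-- Finitely many elements of a field specialise to positive characteristic, keeping a given
nonzero one nonzero. -/
lemma exists_specialization {K : Type u} [Field K] {S : Set K} (hS : S.Finite) (f : K) :
    ∃ A : Subring K, S ⊆ A ∧ f⁻¹ ∈ A ∧ ∃ (κ : Type u) (_ : Field κ) (p : ℕ), p.Prime ∧ CharP κ p ∧
      Nonempty (A →+* κ) := by
  let A : Subalgebra ℤ K := Algebra.adjoin ℤ (insert f⁻¹ S)
  have hA : Algebra.FiniteType ℤ A :=
    (Subalgebra.fg_iff_finiteType A).1 (Subalgebra.fg_def.2 ⟨_, hS.insert _, rfl⟩)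
  obtain ⟨𝔪, h𝔪⟩ := Ideal.exists_maximal A
  have hfin : ((Ideal.Quotient.mk 𝔪).comp (algebraMap ℤ A)).FiniteType :=
    RingHom.FiniteType.comp_surjective (RingHom.finiteType_algebraMap.2 hA)
      Ideal.Quotient.mk_surjective
  let : Field (A ⧸ 𝔪) := Ideal.Quotient.field 𝔪
  obtain ⟨p, hp, hchar⟩ := exists_prime_charP_of_finiteType_int (A ⧸ 𝔪)
    (RingHom.ext_int (Int.castRingHom (A ⧸ 𝔪)) _ ▸ hfin)
  exact ⟨A.toSubring, fun x hx => Algebra.subset_adjoin (Set.mem_insert_of_mem _ hx),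
    Algebra.subset_adjoin (Set.mem_insert _ _), A ⧸ 𝔪, inferInstance, p, hp, hchar,
    ⟨Ideal.Quotient.mk 𝔪⟩⟩

/-- If no nonzero linear form kills all the vectors `v i`, some of them form a basis. -/
lemma exists_det_ne_zero {K ι W : Type*} [Field K] [Fintype W] [DecidableEq W] (v : ι → W → K)
    (h : ∀ a : W → K, (∀ i, ∑ w, a w * v i w = 0) → a = 0) :
    ∃ c : W → ι, (Matrix.of fun w w' => v (c w) w').det ≠ 0 := by
  have hspan : Submodule.span K (Set.range v) = ⊤ := by
    by_contra hne
    obtain ⟨f, hf0, hf⟩ := Submodule.exists_le_ker_of_lt_top _ (lt_top_iff_ne_top.2 hne)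
    have ha := h (fun w => f fun j => if w = j then 1 else 0) fun i => by
      simpa [LinearMap.pi_apply_eq_sum_univ f (v i), mul_comm] using
        hf (Submodule.subset_span (Set.mem_range_self i))
    refine hf0 (LinearMap.ext fun x => ?_)
    rw [LinearMap.pi_apply_eq_sum_univ f x]
    exact Finset.sum_eq_zero fun w _ => by simpa using Or.inr (congrFun ha w)
  obtain ⟨κ, a, -, ha, hli⟩ := exists_linearIndependent' K v
  let b := Module.Basis.mk hli (by rw [ha, hspan])
  let e := (Pi.basisFun K W).indexEquiv b
  refine ⟨a ∘ e, IsUnit.ne_zero ?_⟩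
  rw [← Matrix.isUnit_iff_isUnit_det, ← Matrix.linearIndependent_rows_iff_isUnit]
  exact hli.comp e e.injective

/-- In characteristic `p`, a polynomial vanishing to high order at some points yields a polynomial
of proportionally smaller degree vanishing at the Frobenius images of these points. -/
lemma exists_eval_pow_eq_zero {σ κ : Type*} [Fintype σ] [Field κ] {p : ℕ} [Fact p.Prime]
    [CharP κ p] {F : MvPolynomial σ κ} (hF : F ≠ 0) {N m : ℕ} (hN : F.totalDegree ≤ N)
    (hm : 1 ≤ m) :
    ∃ G : MvPolynomial σ κ, G ≠ 0 ∧ m * G.totalDegree ≤ (Fintype.card σ + 1) * N ∧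
      ∃ q, ∀ z, VanishesToOrder F z m → eval (fun i => z i ^ p ^ q) G = 0 := by
  have hp : p.Prime := Fact.out
  have hmq : m ≤ p ^ m := (Nat.lt_pow_self hp.one_lt).le
  have hq : 0 < p ^ m := pow_pos hp.pos m
  set j := Fintype.card σ * p ^ m / m + 1 with hj
  have hj1 : Fintype.card σ * p ^ m + 1 ≤ m * j := Nat.lt_mul_div_succ _ hm
  have hj2 : m * j ≤ (Fintype.card σ + 1) * p ^ m := by
    have := Nat.mul_div_le (Fintype.card σ * p ^ m) m
    rw [hj]
    linarith
  obtain ⟨a, ha, hne⟩ := exists_powComponent_ne_zero hq (pow_ne_zero j hF)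
  refine ⟨_, hne, ?_, m, fun z hz => eval_powComponent_eq_zero ha
    ((hz.pow j).mono hj1).mem_span_pow⟩
  have hdeg : p ^ m * (powComponent (p ^ m) a (F ^ j)).totalDegree ≤ j * N :=
    (totalDegree_powComponent_le ha _).trans
      ((totalDegree_pow _ _).trans (Nat.mul_le_mul_left _ hN))
  refine Nat.le_of_mul_le_mul_left ?_ hq
  calc p ^ m * (m * (powComponent (p ^ m) a (F ^ j)).totalDegree)
      = m * (p ^ m * (powComponent (p ^ m) a (F ^ j)).totalDegree) := by ring
    _ ≤ m * (j * N) := Nat.mul_le_mul_left _ hdeg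
    _ = (m * j) * N := by ring
    _ ≤ ((Fintype.card σ + 1) * p ^ m) * N := Nat.mul_le_mul_right _ hj2
    _ = p ^ m * ((Fintype.card σ + 1) * N) := by ring

/-- If a nonzero polynomial of degree at most `N` vanishes to order at least `m` on a set, then
this set lies on a hypersurface of degree at most `(dim + 1) * N / m`. -/
theorem exists_hypersurface_of_vanishesToOrder {σ K : Type*} [Fintype σ] [Field K]
    {F : MvPolynomial σ K} (hF : F ≠ 0) {N m : ℕ} (hN : F.totalDegree ≤ N) (hm : 1 ≤ m) :
    ∃ G : MvPolynomial σ K, G ≠ 0 ∧ m * G.totalDegree ≤ (Fintype.card σ + 1) * N ∧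
      ∀ z, VanishesToOrder F z m → eval z G = 0 := by
  classical
  let W := {b : σ →₀ ℕ // m * b.degree ≤ (Fintype.card σ + 1) * N}
  have hW : Finite W :=
    ((Finsupp.finite_of_degree_le ((Fintype.card σ + 1) * N)).subset fun b hb =>
      (Nat.le_mul_of_pos_left _ hm).trans hb).to_subtype
  let _ := Fintype.ofFinite W
  by_contra! hno
  let ev {R : Type _} [CommRing R] (z : σ → R) (b : W) : R := ∏ i, z i ^ b.1 i
  obtain ⟨c, hc⟩ := exists_det_ne_zero
    (fun (z : {z // VanishesToOrder F z m}) (b : W) => ev z.1 b) fun a ha => by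
      by_contra ha0
      obtain ⟨b₀, hb₀⟩ := Function.ne_iff.1 ha0
      have hcoeff (b : W) : coeff b.1 (∑ b : W, monomial b.1 (a b)) = a b := by
        rw [coeff_sum, Finset.sum_eq_single b] <;>
          simp +contextual [coeff_monomial, Subtype.coe_inj]
      obtain ⟨z, hz, hz0⟩ := hno (∑ b : W, monomial b.1 (a b))
        (ne_zero_iff.2 ⟨b₀.1, by rw [hcoeff]; simpa using hb₀⟩) (by
          rw [mul_comm, ← Nat.le_div_iff_mul_le hm]
          refine totalDegree_finsetSum_le fun b _ => (totalDegree_monomial_le _ _).trans ?_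
          rw [Nat.le_div_iff_mul_le hm, mul_comm]
          exact b.2)
      exact hz0 (by simpa [eval_monomial, Finsupp.prod_fintype, ev] using ha ⟨z, hz⟩)
  set E : Matrix W W K := Matrix.of fun w w' => ev (c w).1 w' with hE
  obtain ⟨d, hd⟩ := ne_zero_iff.1 hF
  obtain ⟨A, hSA, hfA, κ, _, p, hp, hchar, ⟨φ⟩⟩ := exists_specialization
    (S := (F.coeffs : Set K) ∪ Set.range fun x : W × σ => (c x.1).1 x.2)
    (F.coeffs.finite_toSet.union (Set.finite_range _)) (E.det * coeff d F)
  have : Fact p.Prime := ⟨hp⟩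
  obtain ⟨FA, hFA⟩ := mem_range_map_iff_coeffs_subset (f := A.subtype) (x := F) |>.2
    fun x hx => ⟨⟨x, hSA (Or.inl hx)⟩, rfl⟩
  let zA (w : W) (i : σ) : A := ⟨(c w).1 i, hSA (Or.inr ⟨(w, i), rfl⟩)⟩
  let EA : Matrix W W A := Matrix.of fun w w' => ev (zA w) w'
  have hEA : A.subtype EA.det = E.det := by
    rw [RingHom.map_det]
    congr 1
    ext w w'
    simp [EA, hE, ev, zA]
  have hunit : EA.det * coeff d FA * ⟨_, hfA⟩ = 1 := by
    apply Subtype.val_injective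
    change A.subtype EA.det * A.subtype (coeff d FA) * (E.det * coeff d F)⁻¹ = 1
    rw [hEA, ← coeff_map, hFA]
    exact mul_inv_cancel₀ (mul_ne_zero hc hd)
  have hφ : φ EA.det * φ (coeff d FA) ≠ 0 := by
    rw [← map_mul]
    exact left_ne_zero_of_mul_eq_one (by rw [← map_mul, hunit, map_one])
  obtain ⟨hφdet, hφd⟩ := mul_ne_zero_iff.1 hφ
  obtain ⟨G, hG0, hGdeg, q, hG⟩ := exists_eval_pow_eq_zero (p := p) (N := N) (m := m)
    (F := map φ FA) (ne_zero_iff.2 ⟨d, by rwa [coeff_map]⟩)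
    (le_trans (Finset.sup_mono ((support_map_subset φ FA).trans_eq
      (by rw [← hFA, support_map_of_injective _ Subtype.val_injective]))) hN) hm
  have hGz (w : W) : eval (fun i => φ (zA w i) ^ p ^ q) G = 0 := by
    refine hG (φ ∘ zA w) (VanishesToOrder.map φ (VanishesToOrder.of_map
      (f := A.subtype) Subtype.val_injective ?_))
    rw [hFA]
    exact (c w).2
  have hsupp (b) (hb : b ∈ G.support) : m * b.degree ≤ (Fintype.card σ + 1) * N :=
    (Nat.mul_le_mul_left _ (le_totalDegree hb)).trans hGdeg
  have hmul : (EA.map fun x => φ x ^ p ^ q).mulVec (fun w => coeff w.1 G) = 0 := by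
    ext w
    rw [Pi.zero_apply, ← hGz w, eval_eq']
    simp only [Matrix.mulVec, dotProduct, Matrix.map_apply, EA, Matrix.of_apply, ev, map_prod,
      map_pow, ← Finset.prod_pow]
    refine (Finset.sum_map Finset.univ ⟨Subtype.val, Subtype.val_injective⟩
      fun b => (∏ i, (φ (zA w i) ^ b i) ^ p ^ q) * coeff b G).symm.trans ?_
    refine (Finset.sum_subset (fun b hb => Finset.mem_map.2 ⟨⟨b, hsupp b hb⟩, by simp⟩)
      fun b _ hb => by rw [notMem_support_iff.1 hb, mul_zero]).symm.trans ?_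
    refine Finset.sum_congr rfl fun b _ => ?_
    rw [mul_comm]
    simp only [← pow_mul, mul_comm]
  have hdet : (EA.map fun x => φ x ^ p ^ q).det ≠ 0 := by
    have : (EA.map fun x => φ x ^ p ^ q) = ((iterateFrobenius κ p q).comp φ).mapMatrix EA := rfl
    rw [this, ← RingHom.map_det]
    exact pow_ne_zero _ hφdet
  have hzero := Matrix.eq_zero_of_mulVec_eq_zero hdet hmul
  refine hG0 (MvPolynomial.ext _ _ fun b => ?_)
  by_contra hb
  exact hb (congrFun hzero ⟨b, hsupp b (mem_support_iff.2 hb)⟩)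

section DeterminantalLoci

variable {σ K : Type*} [Field K]

lemma det_mem_pow_idealOfVars {r : ℕ} [DecidableEq K]
    {B : Matrix (Fin r) (Fin r) (MvPolynomial σ K)} {D : Fin r → K}
    (hB : ∀ i j, coeff 0 (B i j) = Matrix.diagonal D i j) :
    B.det ∈ idealOfVars σ K ^ Fintype.card {i // D i = 0} := by
  rw [Matrix.det_apply']
  refine Ideal.sum_mem _ fun τ _ => Ideal.mul_mem_left _ _ ?_
  have hentry (i : Fin r) (hi : D i = 0) : B (τ i) i ∈ idealOfVars σ K := by
    rw [← pow_one (idealOfVars σ K), mem_pow_idealOfVars_iff']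
    intro x hx
    obtain rfl : x = 0 := (Finsupp.degree_eq_zero_iff x).1 (Nat.lt_one_iff.1 hx)
    rw [hB, Matrix.diagonal_apply]
    split_ifs with h
    · rw [h, hi]
    · rfl
  rw [← Finset.prod_filter_mul_prod_filter_not Finset.univ fun i => D i = 0, Fintype.card_subtype,
    ← Finset.prod_const]
  exact Ideal.mul_mem_right _ _
    (Ideal.prod_mem_prod fun i hi => hentry i (Finset.mem_filter.1 hi).2)

/-- A determinant vanishes to order at least the corank of the matrix. -/
lemma vanishesToOrder_det {r : ℕ} (M : Matrix (Fin r) (Fin r) (MvPolynomial σ K)) {z : σ → K}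
    {m : ℕ} (h : (M.map (eval z)).rank + m ≤ r) : VanishesToOrder M.det z m := by
  classical
  obtain ⟨L, L', D, hD⟩ :=
    Matrix.Pivot.exists_list_transvec_mul_mul_list_transvec_eq_diagonal (M.map (eval z))
  obtain ⟨U, hU⟩ : ∃ U, U = (L.map Matrix.TransvectionStruct.toMatrix).prod := ⟨_, rfl⟩
  obtain ⟨U', hU'⟩ : ∃ U', U' = (L'.map Matrix.TransvectionStruct.toMatrix).prod := ⟨_, rfl⟩
  have hUdet : U.det = 1 := by rw [hU, Matrix.TransvectionStruct.det_toMatrix_prod]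
  have hUdet' : U'.det = 1 := by rw [hU', Matrix.TransvectionStruct.det_toMatrix_prod]
  rw [← hU, ← hU'] at hD
  clear hU hU'
  have hrank : m ≤ Fintype.card {i // D i = 0} := by
    have := Matrix.rank_diagonal D
    rw [← hD, Matrix.rank_mul_eq_left_of_isUnit_det _ _ (by rw [hUdet']; exact isUnit_one),
      Matrix.rank_mul_eq_right_of_isUnit_det _ _ (by rw [hUdet]; exact isUnit_one)] at this
    have hc := Fintype.card_subtype_compl fun i => D i = 0
    have hle := Fintype.card_subtype_le fun i => D i = 0
    rw [Fintype.card_fin] at hc hle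
    rw [this, hc] at h
    omega
  let S := (aeval (R := K) (fun i => (X i + C (z i) : MvPolynomial σ K))).toRingHom
  have hS : (constantCoeff (R := K)).comp S = eval z := by ext i <;> simp [S]
  have hdet : S M.det = (C.mapMatrix U * S.mapMatrix M * C.mapMatrix U').det := by
    rw [Matrix.det_mul, Matrix.det_mul, ← RingHom.map_det, ← RingHom.map_det,
      ← RingHom.map_det, hUdet, hUdet', map_one, one_mul, mul_one]
  have hC (U : Matrix (Fin r) (Fin r) K) :
      constantCoeff.mapMatrix ((C (σ := σ)).mapMatrix U) = U := by
    ext; simp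
  have hcc : constantCoeff.mapMatrix (C.mapMatrix U * S.mapMatrix M * C.mapMatrix U') =
      Matrix.diagonal D := by
    rw [map_mul, map_mul, hC, hC, ← hD, ← hS]
    rfl
  change S M.det ∈ _
  rw [hdet]
  exact Ideal.pow_le_pow_right hrank
    (det_mem_pow_idealOfVars fun i j => congrFun (congrFun hcc i) j)

lemma totalDegree_det_le {r : ℕ} {M : Matrix (Fin r) (Fin r) (MvPolynomial σ K)}
    (h : ∀ i j, (M i j).totalDegree ≤ 1) : M.det.totalDegree ≤ r := by
  rw [Matrix.det_apply]
  refine totalDegree_finsetSum_le fun τ _ => (totalDegree_smul_le _ _).trans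
    ((totalDegree_finsetProd _ _).trans ?_)
  simpa using Finset.sum_le_sum fun i (_ : i ∈ Finset.univ) => h (τ i) i

/-- In a family of linear maps depending affinely on parameters, the locus where the corank is at
least `2 * m` lies on a hypersurface of small degree, if the corank is somewhere less than `m`. -/
theorem exists_hypersurface_of_corank [Fintype σ] {U V : Type*} [AddCommGroup U] [Module K U]
    [AddCommGroup V] [Module K V] [FiniteDimensional K V] (T₀ : U →ₗ[K] V) (T : σ → U →ₗ[K] V)
    {m : ℕ} (hm : 1 ≤ m) {z₀ : σ → K}
    (hz₀ : Module.finrank K V < Module.finrank K (T₀ + ∑ i, z₀ i • T i).range + m) :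
    ∃ G : MvPolynomial σ K, G ≠ 0 ∧
      m * G.totalDegree ≤ (Fintype.card σ + 1) * Module.finrank K V ∧
      ∀ z : σ → K, Module.finrank K (T₀ + ∑ i, z i • T i).range + 2 * m ≤ Module.finrank K V →
        eval z G = 0 := by
  set r := Module.finrank K (T₀ + ∑ i, z₀ i • T i).range with hr
  have hrV : r ≤ Module.finrank K V := Submodule.finrank_le _
  let b := Module.finBasis K (T₀ + ∑ i, z₀ i • T i).range
  choose u hu using fun i => (b i).2
  obtain ⟨Q, hQ⟩ := LinearMap.exists_leftInverse_of_injective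
    ((T₀ + ∑ i, z₀ i • T i).range.subtype ∘ₗ b.equivFun.symm.toLinearMap)
    (LinearMap.ker_eq_bot.2 (Subtype.val_injective.comp b.equivFun.symm.injective))
  let M : Matrix (Fin r) (Fin r) (MvPolynomial σ K) := Matrix.of fun i j =>
    C (Q (T₀ (u j)) i) + ∑ l, X l * C (Q (T l (u j)) i)
  have hM (z : σ → K) : M.map (eval z) =
      Matrix.of fun i j => Q ((T₀ + ∑ l, z l • T l) (u j)) i := by
    ext i j
    simp [M, LinearMap.sum_apply]
  have hM₀ : M.map (eval z₀) = 1 := by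
    rw [hM]
    ext i j
    have := LinearMap.congr_fun hQ (Pi.single j 1)
    simp only [LinearMap.comp_apply, LinearEquiv.coe_coe, Module.Basis.equivFun_symm_apply,
      LinearMap.id_apply] at this
    rw [Matrix.of_apply, hu, Matrix.one_apply]
    simpa [Pi.single_apply, Finset.sum_ite_eq'] using congrFun this i
  have hdet : M.det ≠ 0 := fun h0 => by
    have : eval z₀ M.det = 1 := by
      rw [RingHom.map_det, RingHom.mapMatrix_apply, hM₀, Matrix.det_one]
    simp [h0] at this
  have hdeg : M.det.totalDegree ≤ Module.finrank K V := by
    refine (totalDegree_det_le fun i j => ?_).trans hrV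
    refine (totalDegree_add _ _).trans (max_le (by simp) (totalDegree_finsetSum_le fun l _ => ?_))
    refine (totalDegree_mul _ _).trans ?_
    simp
  obtain ⟨G, hG0, hGdeg, hG⟩ := exists_hypersurface_of_vanishesToOrder hdet hdeg hm
  refine ⟨G, hG0, hGdeg, fun z hz => hG z (vanishesToOrder_det M ?_)⟩
  have hle : (M.map (eval z)).rank ≤ Module.finrank K (T₀ + ∑ i, z i • T i).range := by
    rw [Matrix.rank_eq_finrank_span_cols, hM]
    refine le_trans (Submodule.finrank_mono (Submodule.span_le.2 ?_))
      (Submodule.finrank_map_le Q (T₀ + ∑ i, z i • T i).range)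
    rintro _ ⟨j, rfl⟩
    exact ⟨_, ⟨u j, rfl⟩, rfl⟩
  omega

end DeterminantalLoci

section RowSpaces

open Module

variable {K : Type*} [Field K]

lemma finrank_range_linearCombination_add {ι A : Type*} [Fintype ι] [CommRing A] [Algebra K A]
    [FiniteDimensional K A] (g : ι → A) :
    finrank K ((Fintype.linearCombination A g).restrictScalars K).range +
      finrank K (A ⧸ Ideal.span (Set.range g)) = finrank K A := by
  have h : ((Fintype.linearCombination A g).restrictScalars K).range =
      (Ideal.span (Set.range g)).restrictScalars K := by
    rw [LinearMap.range_restrictScalars, Fintype.range_linearCombination]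
  rw [h, add_comm]
  exact ((Ideal.span (Set.range g)).restrictScalars K).finrank_quotient_add_finrank

lemma finrank_quotient_le_of_le_s4 {A : Type*} [CommRing A] [Algebra K A] {I₁ I₂ : Ideal A}
    [FiniteDimensional K (A ⧸ I₁)] (h : I₁ ≤ I₂) :
    finrank K (A ⧸ I₂) ≤ finrank K (A ⧸ I₁) :=
  LinearMap.finrank_le_finrank_of_surjective (f := (Ideal.Quotient.factorₐ K h).toLinearMap)
    (Ideal.Quotient.factor_surjective h)

lemma finrank_quotient_sup_span {ι A : Type*} [CommRing A] [Algebra K A] (I : Ideal A)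
    (g : ι → A) :
    finrank K (A ⧸ I ⊔ Ideal.span (Set.range g)) =
      finrank K ((A ⧸ I) ⧸ Ideal.span (Set.range fun i => Ideal.Quotient.mk I (g i))) := by
  have h : (Ideal.span (Set.range g)).map (Ideal.Quotient.mkₐ K I) =
      Ideal.span (Set.range fun i => Ideal.Quotient.mk I (g i)) := by
    rw [Ideal.map_span, ← Set.range_comp]
    rfl
  rw [← h]
  exact (DoubleQuot.quotQuotEquivQuotSupₐ K I _).toLinearEquiv.finrank_eq.symm

/-- The ideal of the row space of the matrix whose columns indexed by `c` form the identity matrix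
and whose other columns are given by `B`. -/
noncomputable def chartIdeal {n k : ℕ} (c : Fin k → Fin n)
    (B : Fin k × {j // j ∉ Set.range c} → K) : Ideal (MvPolynomial (Fin n) K) :=
  Ideal.span (Set.range fun j : {j // j ∉ Set.range c} =>
    (X j.1 - ∑ i, C (B (i, j)) * X (c i) : MvPolynomial (Fin n) K))

/-- The affine coordinates of the row space of `M` in the chart of the Grassmannian given by the
nonvanishing of the minor of `M` on the columns `c`. -/
noncomputable def chartCoords {n k : ℕ} (c : Fin k → Fin n) (M : Matrix (Fin k) (Fin n) K) :
    Fin k × {j // j ∉ Set.range c} → K :=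
  fun p => (M.submatrix id (Function.update c p.1 p.2)).det / (M.submatrix id c).det

lemma sum_mul_chartCoords {n k : ℕ} {c : Fin k → Fin n} {M : Matrix (Fin k) (Fin n) K}
    (hM : (M.submatrix id c).det ≠ 0) (a : Fin k) (j : {j // j ∉ Set.range c}) :
    ∑ i, M a (c i) * chartCoords c M (i, j) = M a j := by
  have h := congrFun (Matrix.mulVec_cramer (M.submatrix id c) fun a => M a j) a
  simp only [Matrix.mulVec, dotProduct, Matrix.submatrix_apply, id, Pi.smul_apply,
    smul_eq_mul] at h
  have h' : ∀ i, (M.submatrix id c).cramer (fun a => M a j) i =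
      (M.submatrix id (Function.update c i j)).det := by
    intro i
    rw [Matrix.cramer_apply]
    congr 1
    ext p q
    by_cases hq : q = i
    · subst hq; simp
    · simp [Matrix.updateCol_ne, hq]
  simp only [h'] at h
  simp only [chartCoords, mul_div_assoc', ← Finset.sum_div]
  rw [h]
  field_simp

end RowSpaces

section ChartIdeal

open Module

variable {K : Type} [Field K] {n k : ℕ}

lemma chartIdeal_le_linearSubspaceIdeal {c : Fin k → Fin n} {M : Matrix (Fin k) (Fin n) K}
    (hM : (M.submatrix id c).det ≠ 0) :
    chartIdeal c (chartCoords c M) ≤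
      linearSubspaceIdeal K n (Submodule.span K (Set.range fun i => M i)) := by
  refine Ideal.span_le.2 ?_
  rintro _ ⟨j, rfl⟩
  refine Ideal.subset_span ⟨?_, fun x hx => ?_⟩
  · refine (isHomogeneous_X _ _).sub (IsHomogeneous.sum _ _ _ fun i _ => ?_)
    simpa using (isHomogeneous_C _ _).mul (isHomogeneous_X K (c i))
  · induction hx using Submodule.span_induction with
    | mem x hx =>
      obtain ⟨a, rfl⟩ := hx
      simp only [map_sub, map_sum, map_mul, eval_X, eval_C]
      rw [← sum_mul_chartCoords hM a j, sub_eq_zero]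
      exact Finset.sum_congr rfl fun i _ => mul_comm _ _
    | zero => simp
    | add x y _ _ hx hy =>
      simp only [map_sub, map_sum, map_mul, eval_X, eval_C, Pi.add_apply, mul_add,
        Finset.sum_add_distrib] at hx hy ⊢
      linear_combination hx + hy
    | smul t x _ hx =>
      simp only [map_sub, map_sum, map_mul, eval_X, eval_C, Pi.smul_apply, smul_eq_mul,
        mul_left_comm _ t, ← Finset.mul_sum] at hx ⊢
      linear_combination t * hx

lemma exists_sub_sum_mem_chartIdeal (c : Fin k → Fin n)
    (B : Fin k × {j // j ∉ Set.range c} → K) {f : MvPolynomial (Fin n) K}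
    (hf : f.IsHomogeneous 1) :
    ∃ a : Fin k → K, f - ∑ i, C (a i) * X (c i) ∈ chartIdeal c B := by
  have hf' : f ∈ Submodule.span K (Set.range (X : Fin n → MvPolynomial (Fin n) K)) := by
    rwa [← homogeneousSubmodule_one_eq_span_X]
  induction hf' using Submodule.span_induction with
  | mem x hx =>
    obtain ⟨j, rfl⟩ := hx
    by_cases hj : j ∈ Set.range c
    · obtain ⟨i, rfl⟩ := hj
      refine ⟨Pi.single i 1, ?_⟩
      rw [Finset.sum_eq_single i (fun b _ hb => by simp [hb]) (by simp)]
      simp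
    · exact ⟨fun i => B (i, ⟨j, hj⟩), Ideal.subset_span ⟨⟨j, hj⟩, rfl⟩⟩
  | zero => exact ⟨0, by simp⟩
  | add x y hx hy ihx ihy =>
    obtain ⟨a, ha⟩ := ihx (by rwa [← mem_homogeneousSubmodule, homogeneousSubmodule_one_eq_span_X])
    obtain ⟨b, hb⟩ := ihy (by rwa [← mem_homogeneousSubmodule, homogeneousSubmodule_one_eq_span_X])
    refine ⟨a + b, ?_⟩
    convert add_mem ha hb using 1
    simp only [Pi.add_apply, map_add, add_mul, Finset.sum_add_distrib]
    ring
  | smul t x hx ihx =>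
    obtain ⟨a, ha⟩ := ihx (by rwa [← mem_homogeneousSubmodule, homogeneousSubmodule_one_eq_span_X])
    refine ⟨t • a, ?_⟩
    convert Ideal.mul_mem_left _ (C t) ha using 1
    simp only [Pi.smul_apply, smul_eq_mul, map_mul, mul_assoc, mul_sub, Finset.mul_sum,
      smul_eq_C_mul]

lemma linearSubspaceIdeal_le_chartIdeal {c : Fin k → Fin n} {M : Matrix (Fin k) (Fin n) K}
    (hM : (M.submatrix id c).det ≠ 0) :
    linearSubspaceIdeal K n (Submodule.span K (Set.range fun i => M i)) ≤
      chartIdeal c (chartCoords c M) := by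
  refine Ideal.span_le.2 fun f hf => ?_
  obtain ⟨a, ha⟩ := exists_sub_sum_mem_chartIdeal c (chartCoords c M) hf.1
  have h0 : ∀ g ∈ chartIdeal c (chartCoords c M), ∀ i, eval (M i) g = 0 := by
    intro g hg i
    have : chartIdeal c (chartCoords c M) ≤ RingHom.ker (eval (M i)) := by
      refine Ideal.span_le.2 ?_
      rintro _ ⟨j, rfl⟩
      simp only [SetLike.mem_coe, RingHom.mem_ker, map_sub, map_sum, map_mul, eval_X, eval_C]
      rw [← sum_mul_chartCoords hM i j, sub_eq_zero]
      exact Finset.sum_congr rfl fun i _ => mul_comm _ _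
    exact this hg
  have h1 : (M.submatrix id c).mulVec a = 0 := by
    ext i
    have h := h0 _ ha i
    rw [map_sub, hf.2 _ (Submodule.subset_span ⟨i, rfl⟩), zero_sub, neg_eq_zero] at h
    simpa [Matrix.mulVec, dotProduct, mul_comm] using h
  have h2 : a = 0 := Matrix.eq_zero_of_mulVec_eq_zero hM h1
  simpa [h2] using ha

lemma exists_minor_ne_zero {M : Matrix (Fin k) (Fin n) K}
    (hM : LinearIndependent K fun i => M i) :
    ∃ c : Fin k → Fin n, (M.submatrix id c).det ≠ 0 := by
  obtain ⟨c, hc⟩ := exists_det_ne_zero (fun j i => M i j) fun a ha => by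
    refine funext fun i => Fintype.linearIndependent_iff.1 hM a ?_ i
    ext j
    simpa using ha j
  refine ⟨c, ?_⟩
  rwa [← Matrix.det_transpose]

end ChartIdeal

section PluckerForms

variable {K : Type} [Field K] {n k : ℕ}

lemma injective_of_det_submatrix_ne_zero {M : Matrix (Fin k) (Fin n) K} {c : Fin k → Fin n}
    (hM : (M.submatrix id c).det ≠ 0) : Function.Injective c := by
  intro i j hij
  by_contra h
  exact hM (Matrix.det_zero_of_column_eq h fun a => by simp [hij])

lemma exists_pluckerForm (K : Type) [Field K] (c : Fin k → Fin n) :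
    ∃ Y : MvPolynomial {s : Finset (Fin n) // s.card = k} K, Y.IsHomogeneous 1 ∧
      ∀ M : Matrix (Fin k) (Fin n) K, eval (pluckerCoords M) Y = (M.submatrix id c).det := by
  by_cases hc : Function.Injective c
  · let s : Finset (Fin n) := Finset.univ.image c
    have hs : s.card = k := by simp [s, Finset.card_image_of_injective _ hc]
    let e := s.orderIsoOfFin hs
    let f : Fin k → Fin k := fun i => e.symm ⟨c i, by simp [s]⟩
    have hf : Function.Injective f := by
      intro i j hij
      exact hc (congrArg Subtype.val (e.symm.injective hij))
    let π : Equiv.Perm (Fin k) := Equiv.ofBijective f (Finite.injective_iff_bijective.1 hf)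
    refine ⟨C ((Equiv.Perm.sign π : ℤ) : K) * X ⟨s, hs⟩, ?_, fun M => ?_⟩
    · exact zero_add 1 ▸ (isHomogeneous_C _ _).mul (isHomogeneous_X K _)
    · rw [map_mul, eval_C, eval_X, pluckerCoords, ← Matrix.det_permute']
      congr 1
      ext i j
      have : (e (π j) : Fin n) = c j := by simp [π, f]
      simp only [Matrix.submatrix_apply, Matrix.of_apply, id]
      exact congrArg (M i) this
  · refine ⟨0, isHomogeneous_zero _ _ _, fun M => ?_⟩
    by_contra h
    exact hc (injective_of_det_submatrix_ne_zero (Ne.symm (by simpa using h)))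

end PluckerForms

section Homogenization

variable {σ τ K : Type*} [Field K]

lemma eval_mul_of_isHomogeneous {d : ℕ} {φ : MvPolynomial σ K} (hφ : φ.IsHomogeneous d) (t : K)
    (x : σ → K) : eval (fun i => t * x i) φ = t ^ d * eval x φ := by
  rw [eval_eq, eval_eq, Finset.mul_sum]
  refine Finset.sum_congr rfl fun s hs => ?_
  rw [hφ.degree_eq_sum_deg_support hs, ← Finset.prod_pow_eq_pow_sum]
  simp only [mul_pow, Finset.prod_mul_distrib]
  ring

lemma eval_aeval (p : τ → K) (Y : σ → MvPolynomial τ K) (φ : MvPolynomial σ K) :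
    eval p (aeval Y φ) = eval (fun i => eval p (Y i)) φ := by
  have h : (aeval p).comp (aeval Y) = aeval (R := K) fun i => eval p (Y i) := by
    ext i
    simp [aeval_eq_eval]
  simpa [aeval_eq_eval] using AlgHom.congr_fun h φ

/-- The homogenization of `G`, evaluated at the forms `Y₀` (for the homogenizing variable)
and `Y`, times an additional factor `Y₀`. -/
noncomputable def homogenize (G : MvPolynomial σ K) (Y₀ : MvPolynomial τ K)
    (Y : σ → MvPolynomial τ K) : MvPolynomial τ K :=
  Y₀ * ∑ d ∈ Finset.range (G.totalDegree + 1),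
    Y₀ ^ (G.totalDegree - d) * aeval Y (homogeneousComponent d G)

lemma isHomogeneous_homogenize (G : MvPolynomial σ K) {Y₀ : MvPolynomial τ K}
    {Y : σ → MvPolynomial τ K} (hY₀ : Y₀.IsHomogeneous 1) (hY : ∀ i, (Y i).IsHomogeneous 1) :
    (homogenize G Y₀ Y).IsHomogeneous (1 + G.totalDegree) := by
  refine hY₀.mul (IsHomogeneous.sum _ _ _ fun d hd => ?_)
  have h := (hY₀.pow (G.totalDegree - d)).mul
    ((homogeneousComponent_isHomogeneous d G).aeval Y hY)
  rwa [one_mul, one_mul, Nat.sub_add_cancel (Nat.lt_succ_iff.1 (Finset.mem_range.1 hd))] at h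

lemma eval_homogenize (G : MvPolynomial σ K) (Y₀ : MvPolynomial τ K)
    (Y : σ → MvPolynomial τ K) (p : τ → K) :
    eval p (homogenize G Y₀ Y) =
      eval p Y₀ ^ (G.totalDegree + 1) * eval (fun i => eval p (Y i) / eval p Y₀) G := by
  by_cases h0 : eval p Y₀ = 0
  · simp [homogenize, h0]
  have hG : eval (fun i => eval p (Y i) / eval p Y₀) G = ∑ d ∈ Finset.range (G.totalDegree + 1),
      eval (fun i => eval p (Y i) / eval p Y₀) (homogeneousComponent d G) := by
    rw [← map_sum, sum_homogeneousComponent]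
  simp only [hG, homogenize, map_mul, map_sum, map_pow, Finset.mul_sum]
  refine Finset.sum_congr rfl fun d hd => ?_
  have hd' : d ≤ G.totalDegree := Nat.lt_succ_iff.1 (Finset.mem_range.1 hd)
  have hY : eval p (aeval Y (homogeneousComponent d G)) =
      eval p Y₀ ^ d * eval (fun i => eval p (Y i) / eval p Y₀) (homogeneousComponent d G) := by
    rw [← eval_mul_of_isHomogeneous (homogeneousComponent_isHomogeneous d G)]
    simp only [mul_div_cancel₀ _ h0]
    exact eval_aeval p Y _
  rw [hY, ← mul_assoc, ← mul_assoc, ← pow_succ', ← pow_add]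
  congr 2
  omega

end Homogenization

section RichDirections

open Module

variable {K : Type} [Field K] {n k : ℕ}

lemma exists_hypersurface_of_linear_span {K A κ ι : Type*} [Field K] [CommRing A] [Algebra K A]
    [FiniteDimensional K A] [Fintype κ] [Fintype ι] (x : ι → A) (y : κ → A) {m : ℕ} (hm : 1 ≤ m)
    {B₀ : κ × ι → K}
    (hB₀ : finrank K (A ⧸ Ideal.span (Set.range fun j => x j - ∑ i, B₀ (i, j) • y i)) < m) :
    ∃ G : MvPolynomial (κ × ι) K, G ≠ 0 ∧
      m * G.totalDegree ≤ (Fintype.card κ * Fintype.card ι + 1) * finrank K A ∧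
      ∀ B : κ × ι → K,
        2 * m ≤ finrank K (A ⧸ Ideal.span (Set.range fun j => x j - ∑ i, B (i, j) • y i)) →
          eval B G = 0 := by
  classical
  let T₀ : (ι → A) →ₗ[K] A := (Fintype.linearCombination A x).restrictScalars K
  let T (p : κ × ι) : (ι → A) →ₗ[K] A :=
    (Fintype.linearCombination A (Pi.single p.2 (-y p.1))).restrictScalars K
  have hT (B : κ × ι → K) : T₀ + ∑ p, B p • T p =
      (Fintype.linearCombination A fun j => x j - ∑ i, B (i, j) • y i).restrictScalars K := by
    refine LinearMap.ext fun a => ?_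
    have h (p : κ × ι) : T p a = -(a p.2 * y p.1) := by
      simp [T, Fintype.linearCombination_apply, Pi.single_apply]
    simp only [LinearMap.add_apply, LinearMap.sum_apply, LinearMap.smul_apply, h,
      LinearMap.restrictScalars_apply, Fintype.linearCombination_apply, smul_eq_mul, mul_sub, T₀,
      Finset.sum_sub_distrib, Fintype.sum_prod_type_right, smul_neg, Finset.sum_neg_distrib,
      Finset.mul_sum, mul_smul_comm]
    exact (sub_eq_add_neg _ _).symm
  have hrank (B : κ × ι → K) : finrank K (T₀ + ∑ p, B p • T p).range +
      finrank K (A ⧸ Ideal.span (Set.range fun j => x j - ∑ i, B (i, j) • y i)) =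
        finrank K A := by
    rw [hT]
    exact finrank_range_linearCombination_add _
  obtain ⟨G, hG, hdeg, hGB⟩ := exists_hypersurface_of_corank T₀ T hm (z₀ := B₀) (by
    have := hrank B₀
    omega)
  refine ⟨G, hG, by rwa [← Fintype.card_prod], fun B hB => hGB B ?_⟩
  have := hrank B
  omega

lemma exists_hypersurface_of_chart (I : Ideal (MvPolynomial (Fin n) K))
    [FiniteDimensional K (MvPolynomial (Fin n) K ⧸ I)] (c : Fin k → Fin n) {m : ℕ} (hm : 1 ≤ m)
    {B₀ : Fin k × {j // j ∉ Set.range c} → K}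
    (hB₀ : finrank K (MvPolynomial (Fin n) K ⧸ I ⊔ chartIdeal c B₀) < m) :
    ∃ G : MvPolynomial (Fin k × {j // j ∉ Set.range c}) K, G ≠ 0 ∧
      m * G.totalDegree ≤ (k * n + 1) * finrank K (MvPolynomial (Fin n) K ⧸ I) ∧
      ∀ B, 2 * m ≤ finrank K (MvPolynomial (Fin n) K ⧸ I ⊔ chartIdeal c B) → eval B G = 0 := by
  have h (B : Fin k × {j // j ∉ Set.range c} → K) :
      finrank K (MvPolynomial (Fin n) K ⧸ I ⊔ chartIdeal c B) =
        finrank K ((MvPolynomial (Fin n) K ⧸ I) ⧸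
          Ideal.span (Set.range fun j : {j // j ∉ Set.range c} =>
            Ideal.Quotient.mk I (X j.1) - ∑ i, B (i, j) • Ideal.Quotient.mk I (X (c i)))) := by
    have hg (j : {j // j ∉ Set.range c}) :
        Ideal.Quotient.mk I (X j.1 - ∑ i, C (B (i, j)) * X (c i)) =
          Ideal.Quotient.mk I (X j.1) - ∑ i, B (i, j) • Ideal.Quotient.mk I (X (c i)) := by
      simp only [map_sub, map_sum, ← smul_eq_C_mul]
      rfl
    rw [chartIdeal, finrank_quotient_sup_span, funext hg]
  rw [h] at hB₀
  obtain ⟨G, hG, hdeg, hGB⟩ := exists_hypersurface_of_linear_span _ _ hm hB₀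
  refine ⟨G, hG, hdeg.trans (Nat.mul_le_mul_right _ ?_), fun B hB => hGB B (by rwa [← h])⟩
  rw [Fintype.card_fin]
  gcongr
  simpa using Fintype.card_subtype_le fun j => j ∉ Set.range c

/-- The matrix whose columns indexed by `c` form the identity matrix and whose other columns are
given by `B`. -/
noncomputable def chartMatrix (c : Fin k → Fin n) (B : Fin k × {j // j ∉ Set.range c} → K) :
    Matrix (Fin k) (Fin n) K := by
  classical
  exact Matrix.of fun i j =>
    if h : j ∈ Set.range c then (1 : Matrix (Fin k) (Fin k) K) i h.choose else B (i, ⟨j, h⟩)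

lemma chartMatrix_submatrix {c : Fin k → Fin n} (hc : Function.Injective c)
    (B : Fin k × {j // j ∉ Set.range c} → K) : (chartMatrix c B).submatrix id c = 1 := by
  ext i j
  have h : c j ∈ Set.range c := ⟨j, rfl⟩
  rw [Matrix.submatrix_apply, chartMatrix, Matrix.of_apply, dif_pos h, hc h.choose_spec, id]

lemma chartCoords_chartMatrix {c : Fin k → Fin n} (hc : Function.Injective c)
    (B : Fin k × {j // j ∉ Set.range c} → K) : chartCoords c (chartMatrix c B) = B := by
  ext ⟨i, j⟩
  have hM := chartMatrix_submatrix hc B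
  have h := sum_mul_chartCoords (c := c) (M := chartMatrix c B) (by simp [hM]) i j
  have h1 : ∀ a, chartMatrix c B i (c a) = (1 : Matrix (Fin k) (Fin k) K) i a := fun a =>
    congrFun (congrFun hM i) a
  simp only [h1, Matrix.one_apply, ite_mul, one_mul, zero_mul, Finset.sum_ite_eq,
    Finset.mem_univ, if_true] at h
  rw [h]
  rw [chartMatrix, Matrix.of_apply, dif_neg j.2]

/-- If some direction is not `m`-rich, a form of small degree vanishes at the `2m`-rich ones. -/
theorem exists_form_of_rich_directions [Infinite K] (I : Ideal (MvPolynomial (Fin n) K))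
    [FiniteDimensional K (MvPolynomial (Fin n) K ⧸ I)] {m : ℕ} (hm : 1 ≤ m)
    {V₀ : Submodule K (Fin n → K)} (hV₀ : finrank K V₀ = k)
    (hV₀m : finrank K (MvPolynomial (Fin n) K ⧸ (I + linearSubspaceIdeal K n V₀)) < m) :
    ∃ P : MvPolynomial {s : Finset (Fin n) // s.card = k} K, P ≠ 0 ∧
      (∃ d : ℕ, P.IsHomogeneous d) ∧
      m * P.totalDegree ≤ m + (k * n + 1) * finrank K (MvPolynomial (Fin n) K ⧸ I) ∧
      ∀ M : Matrix (Fin k) (Fin n) K,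
        2 * m ≤ finrank K (MvPolynomial (Fin n) K ⧸
          (I + linearSubspaceIdeal K n (Submodule.span K (Set.range fun i => M i)))) →
        eval (pluckerCoords M) P = 0 := by
  have hquot (J : Ideal (MvPolynomial (Fin n) K)) :
      FiniteDimensional K (MvPolynomial (Fin n) K ⧸ I ⊔ J) :=
    Module.Finite.of_surjective (Ideal.Quotient.factorₐ K (le_sup_left : I ≤ I ⊔ J)).toLinearMap
      (Ideal.Quotient.factor_surjective le_sup_left)
  let b := finBasisOfFinrankEq K V₀ hV₀
  let M₀ : Matrix (Fin k) (Fin n) K := Matrix.of fun i => (b i : Fin n → K)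
  have hM₀ : LinearIndependent K fun i => M₀ i :=
    b.linearIndependent.map' V₀.subtype V₀.ker_subtype
  have hM₀V : Submodule.span K (Set.range fun i => M₀ i) = V₀ := by
    have := congrArg (Submodule.map V₀.subtype) b.span_eq
    rwa [Submodule.map_span, ← Set.range_comp, Submodule.map_subtype_top] at this
  obtain ⟨c, hc⟩ := exists_minor_ne_zero hM₀
  obtain ⟨G, hG, hdeg, hGB⟩ := exists_hypersurface_of_chart I c hm (B₀ := chartCoords c M₀) <|
    (finrank_quotient_le_of_le_s4 (sup_le_sup_left (linearSubspaceIdeal_le_chartIdeal hc) I)).trans_lt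
      (by rwa [hM₀V])
  choose Y hY hYM using exists_pluckerForm (n := n) (k := k) K
  have heval (M : Matrix (Fin k) (Fin n) K) : eval (pluckerCoords M)
      (homogenize G (Y c) fun p => Y (Function.update c p.1 p.2)) =
        (M.submatrix id c).det ^ (G.totalDegree + 1) * eval (chartCoords c M) G := by
    rw [eval_homogenize]
    simp only [hYM]
    rfl
  have hhom := isHomogeneous_homogenize G (hY c)
    (Y := fun p : Fin k × {j // j ∉ Set.range c} => Y (Function.update c p.1 p.2)) fun p => hY _
  refine ⟨_, fun h0 => hG ?_, ⟨_, hhom⟩, ?_, fun M hM => ?_⟩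
  · refine MvPolynomial.funext fun B => ?_
    have hinj := injective_of_det_submatrix_ne_zero hc
    have h := heval (chartMatrix c B)
    rw [h0, map_zero, chartMatrix_submatrix hinj, chartCoords_chartMatrix hinj] at h
    simpa using h.symm
  · calc _ ≤ m * (1 + G.totalDegree) := Nat.mul_le_mul_left _ hhom.totalDegree_le
      _ ≤ _ := by rw [mul_add, mul_one]; exact Nat.add_le_add_left hdeg m
  · rw [heval]
    by_cases hMc : (M.submatrix id c).det = 0
    · simp [hMc]
    · rw [hGB _ (hM.trans (finrank_quotient_le_of_le_s4
        (sup_le_sup_left (chartIdeal_le_linearSubspaceIdeal hMc) I))), mul_zero]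

end RichDirections

/-- **Theorem 1.6, part (2)**: if some `k`-dimensional direction fails to be
`m`-rich for the homogeneous 0-dimensional scheme defined by `I`, then the
`2m`-rich `k`-plane directions lie on a hypersurface of degree at most `C₂·N/m`
in the Plücker embedding of `Gr(k,n)`. -/
theorem rich_directions_on_hypersurface (n k : ℕ) (hk1 : 1 ≤ k) (hkn : k ≤ n - 1) :
    ∃ C₂ : ℝ, 0 < C₂ ∧
      ∀ (𝕜 : Type) [Field 𝕜] [IsAlgClosed 𝕜],
      ∀ I : Ideal (MvPolynomial (Fin n) 𝕜),
        IsHomogeneousIdeal I →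
        FiniteDimensional 𝕜 (MvPolynomial (Fin n) 𝕜 ⧸ I) →
        ∀ m : ℕ, 1 ≤ m →
        (∃ V₀ : Submodule 𝕜 (Fin n → 𝕜), Module.finrank 𝕜 V₀ = k ∧
          Module.finrank 𝕜 (MvPolynomial (Fin n) 𝕜 ⧸ (I + linearSubspaceIdeal 𝕜 n V₀)) < m) →
        ∃ P : MvPolynomial {s : Finset (Fin n) // s.card = k} 𝕜,
          P ≠ 0 ∧ (∃ d : ℕ, P.IsHomogeneous d) ∧
          (P.totalDegree : ℝ) ≤
            C₂ * (Module.finrank 𝕜 (MvPolynomial (Fin n) 𝕜 ⧸ I) : ℝ) / (m : ℝ) ∧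
          ∀ V : Submodule 𝕜 (Fin n → 𝕜), Module.finrank 𝕜 V = k →
            2 * m ≤
              Module.finrank 𝕜 (MvPolynomial (Fin n) 𝕜 ⧸ (I + linearSubspaceIdeal 𝕜 n V)) →
            ∀ M : Matrix (Fin k) (Fin n) 𝕜,
              LinearIndependent 𝕜 (fun i => M i) →
              Submodule.span 𝕜 (Set.range (fun i => M i)) = V →
              MvPolynomial.eval (pluckerCoords M) P = 0 := by
  refine ⟨(k * n + 2 : ℕ), by positivity, fun 𝕜 _ _ I _ _ m hm ⟨V₀, hV₀, hV₀m⟩ => ?_⟩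
  have hm' : (0 : ℝ) < m := by exact_mod_cast hm
  obtain hN | hN := lt_or_ge (Module.finrank 𝕜 (MvPolynomial (Fin n) 𝕜 ⧸ I)) m
  · refine ⟨1, one_ne_zero, ⟨0, isHomogeneous_one _ _⟩, ?_, fun V _ hV => ?_⟩
    · rw [totalDegree_one, Nat.cast_zero]
      positivity
    · have := finrank_quotient_le_of_le_s4 (K := 𝕜)
        (le_sup_left : I ≤ I ⊔ linearSubspaceIdeal 𝕜 n V)
      simp only [Submodule.add_eq_sup] at hV
      omega
  · have : Infinite 𝕜 := IsAlgClosed.instInfinite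
    obtain ⟨P, hP, hhom, hdeg, hPM⟩ := exists_form_of_rich_directions I hm hV₀ hV₀m
    refine ⟨P, hP, hhom, ?_, fun V _ hV M _ hMV => hPM M (by rwa [hMV])⟩
    rw [le_div_iff₀ hm']
    norm_cast
    linarith
end

section
/- Fix an integer n ≥ 2. There is a constant C₂ > 0, depending only on n, with the following property. Let 𝕜 be an algebraically closed field, let I ⊆ 𝕜[x₁,…,xₙ] be a homogeneous ideal with N := dim_𝕜 𝕜[x₁,…,xₙ]/I finite, and let m ≥ 1 be an integer. Suppose there exists a nonzero linear form ℓ₀ with dim_𝕜 𝕜[x₁,…,xₙ]/(I + (ℓ₀)) < m. Then there exists a nonzero homogeneous polynomial P ∈ 𝕜[y₁,…,yₙ] of total degree at most C₂·N/m such that P(a₁,…,aₙ) = 0 for every nonzero tuple (a₁,…,aₙ) ∈ 𝕜ⁿ with dim_𝕜 𝕜[x₁,…,xₙ]/(I + (a₁x₁ + ⋯ + aₙxₙ)) ≥ 2m. -/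
open MvPolynomial

theorem finrank_homogeneousSubmodule {σ K : Type*} [Fintype σ] [Field K] (e : ℕ) :
    Module.finrank K (homogeneousSubmodule σ K e) = (Fintype.card σ).multichoose e := by
  classical
  rw [homogeneousSubmodule_eq_finsupp_supported]
  have b := basisRestrictSupport K {d : σ →₀ ℕ | d.degree = e}
  have hs : {d : σ →₀ ℕ | d.degree = e} =
      ((Finset.univ : Finset σ).finsuppAntidiag e : Set (σ →₀ ℕ)) := by
    ext d
    simp [Finset.mem_finsuppAntidiag, Finsupp.degree_eq_sum]
  refine (Module.finrank_eq_nat_card_basis b).trans ?_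
  rw [hs, Nat.card_coe_set_eq, Set.ncard_coe_finset,
    Finset.card_finsuppAntidiag_nat_eq_multichoose, Finset.card_univ]

theorem Nat.succ_mul_multichoose_succ (n e : ℕ) :
    (e + 1) * n.multichoose (e + 1) = (n + e) * n.multichoose e := by
  cases n with
  | zero => cases e <;> simp
  | succ n =>
    rw [Nat.multichoose_eq, Nat.multichoose_eq]
    have h := Nat.add_one_mul_choose_eq (n + e) e
    simp only [show n + 1 + (e + 1) - 1 = n + e + 1 by omega, show n + 1 + e - 1 = n + e by omega]
    linarith

/-- A family of functionals with no common zero has a subfamily with no common zero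
whose size is at most the dimension of the space. -/
theorem exists_subfamily_separating {K S ι : Type*} [Field K] [AddCommGroup S] [Module K S]
    [FiniteDimensional K S] (v : ι → Module.Dual K S)
    (hv : ∀ p, (∀ i, v i p = 0) → p = 0) :
    ∃ t : Finset ι, t.card ≤ Module.finrank K S ∧ ∀ p, (∀ i ∈ t, v i p = 0) → p = 0 := by
  classical
  obtain ⟨κ, a, -, hspan, hli⟩ := exists_linearIndependent' K v
  have := hli.finite
  have := Fintype.ofFinite κ
  refine ⟨Finset.univ.image a, ?_, fun p hp ↦ hv p fun i ↦ ?_⟩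
  · rw [← Subspace.dual_finrank_eq]
    exact Finset.card_image_le.trans hli.fintype_card_le_finrank
  · have hle : Submodule.span K (Set.range (v ∘ a)) ≤ LinearMap.ker (Module.Dual.eval K S p) := by
      rw [Submodule.span_le]
      rintro _ ⟨j, rfl⟩
      exact hp _ (Finset.mem_image_of_mem _ (Finset.mem_univ j))
    exact hle (hspan ▸ Submodule.subset_span ⟨i, rfl⟩)

/-- If the linear system `∑ aᵢ Tᵢ` has large rank at one point, then the
parameters at which its rank is at most `k` lie on a hypersurface of degree `e + 1`. -/
theorem exists_isHomogeneous_eval_eq_zero_of_finrank_range_le {σ K V W : Type*} [Fintype σ]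
    [Field K] [AddCommGroup V] [Module K V] [AddCommGroup W] [Module K W]
    [FiniteDimensional K W] (T : σ → V →ₗ[K] W) (a₀ : σ → K) (k e : ℕ)
    (h : k * (Fintype.card σ).multichoose (e + 1) <
      Module.finrank K (LinearMap.range (∑ i, a₀ i • T i)) * (Fintype.card σ).multichoose e) :
    ∃ P : MvPolynomial σ K, P ≠ 0 ∧ P.IsHomogeneous (e + 1) ∧
      ∀ a : σ → K, Module.finrank K (LinearMap.range (∑ i, a i • T i)) ≤ k → eval a P = 0 := by
  classical
  by_contra! hP
  have hfd (d : ℕ) : FiniteDimensional K (homogeneousSubmodule σ K d) :=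
    Module.Finite.iff_fg.mpr (homogeneousSubmodule_fg σ K d)
  let ι := {a : σ → K // Module.finrank K (LinearMap.range (∑ i, a i • T i)) ≤ k}
  let v (d : ℕ) (a : σ → K) : Module.Dual K (homogeneousSubmodule σ K d) :=
    (aeval a).toLinearMap ∘ₗ (homogeneousSubmodule σ K d).subtype
  obtain ⟨t, htc, ht⟩ := exists_subfamily_separating (fun a : ι ↦ v (e + 1) a.1) (by
    rintro ⟨p, hp⟩ hv
    by_contra hne
    obtain ⟨a, ha, ha'⟩ := hP p (fun h0 ↦ hne (Subtype.ext h0)) hp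
    exact ha' (by simpa [v, coe_aeval_eq_eval] using hv ⟨a, ha⟩))
  set T₀ := ∑ i, a₀ i • T i with hT₀
  let b := Module.finBasis K (LinearMap.range T₀)
  choose u hu using fun j ↦ (b j).2
  choose φ hφ using fun j ↦ (b.coord j).exists_extend
  let M : Matrix (Fin (Module.finrank K (LinearMap.range T₀)))
      (Fin (Module.finrank K (LinearMap.range T₀))) (MvPolynomial σ K) :=
    Matrix.of fun i j ↦ ∑ l, C (φ i (T l (u j))) * X l
  have hM (a : σ → K) (i j) : eval a (M i j) = φ i ((∑ l, a l • T l) (u j)) := by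
    simp [M, mul_comm]
  have hdet : M.det ≠ 0 := by
    intro h0
    have h1 : (eval a₀).mapMatrix M = 1 := by
      ext i j
      rw [RingHom.mapMatrix_apply, Matrix.map_apply, hM, ← hT₀, hu]
      have := LinearMap.congr_fun (hφ i) (b j)
      simpa [Matrix.one_apply, Finsupp.single_apply, eq_comm] using this
    have h2 := RingHom.map_det (eval a₀) M
    rw [h0, h1] at h2
    simp at h2
  let F : (Fin (Module.finrank K (LinearMap.range T₀)) → homogeneousSubmodule σ K e) →ₗ[K]
      (∀ a : t, LinearMap.range (∑ i, a.1.1 i • T i)) :=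
    LinearMap.pi fun a ↦ (∑ i, a.1.1 i • T i).rangeRestrict ∘ₗ
      ∑ j, LinearMap.toSpanSingleton K V (u j) ∘ₗ v e a.1.1 ∘ₗ LinearMap.proj j
  have hF : Function.Injective F := by
    rw [← LinearMap.ker_eq_bot, LinearMap.ker_eq_bot']
    intro f hf
    have hMf : M.mulVec (fun j ↦ (f j : MvPolynomial σ K)) = 0 := by
      funext i
      have hhom : (M.mulVec (fun j ↦ (f j : MvPolynomial σ K)) i).IsHomogeneous (e + 1) := by
        refine IsHomogeneous.sum _ _ _ fun j _ ↦ ?_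
        rw [add_comm]
        refine IsHomogeneous.mul (IsHomogeneous.sum _ _ _ fun l _ ↦ ?_) (f j).2
        exact (isHomogeneous_C_mul_X _ _)
      refine congrArg Subtype.val (ht ⟨_, hhom⟩ fun a ha ↦ ?_)
      have h0 := congrArg (φ i ∘ Subtype.val) (congrFun hf ⟨a, ha⟩)
      have h1 : eval a.1 (M.mulVec (fun j ↦ (f j : MvPolynomial σ K)) i) =
          ∑ j, eval a.1 (f j : MvPolynomial σ K) * φ i ((∑ l, a.1 l • T l) (u j)) := by
        simp only [Matrix.mulVec, dotProduct, map_sum, map_mul, hM, mul_comm]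
      change eval a.1 (M.mulVec (fun j ↦ (f j : MvPolynomial σ K)) i) = 0
      rw [h1]
      simp only [Finset.mul_sum, LinearMap.sum_apply, LinearMap.smul_apply, map_sum, map_smul,
        smul_eq_mul]
      rw [Finset.sum_comm]
      simpa [F, v, coe_aeval_eq_eval, Finset.mul_sum, mul_left_comm] using h0
    funext j
    exact Subtype.ext (congrFun (Matrix.eq_zero_of_mulVec_eq_zero hdet hMf) j)
  have hle := LinearMap.finrank_le_finrank_of_injective hF
  rw [Module.finrank_pi_fintype, Module.finrank_pi_fintype] at hle
  simp only [finrank_homogeneousSubmodule, Finset.sum_const, Finset.card_univ, Fintype.card_fin,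
    smul_eq_mul] at hle htc
  have h2 : ∑ a : t, Module.finrank K (LinearMap.range (∑ i, a.1.1 i • T i)) ≤ t.card * k := by
    refine (Finset.sum_le_card_nsmul _ _ k fun a _ ↦ a.1.2).trans ?_
    simp
  have h3 := Nat.mul_le_mul_right k htc
  linarith

/-- The quotient of `R ⧸ I` by the class of `f` has codimension the rank of multiplication
by `f`. -/
theorem finrank_range_mulLeft_add_finrank_quotient {K R : Type*} [Field K] [CommRing R]
    [Algebra K R] (I : Ideal R) [FiniteDimensional K (R ⧸ I)] (f : R) :
    Module.finrank K (LinearMap.range (LinearMap.mulLeft K (Ideal.Quotient.mk I f))) +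
      Module.finrank K (R ⧸ (I + Ideal.span {f})) = Module.finrank K (R ⧸ I) := by
  let g := (Ideal.Quotient.factorₐ K (le_sup_left : I ≤ I ⊔ Ideal.span {f})).toLinearMap
  have hg : Function.Surjective g := Ideal.Quotient.factor_surjective le_sup_left
  have hker : LinearMap.ker g = LinearMap.range (LinearMap.mulLeft K (Ideal.Quotient.mk I f)) := by
    ext x
    obtain ⟨p, rfl⟩ := Ideal.Quotient.mk_surjective x
    have : g (Ideal.Quotient.mk I p) = Ideal.Quotient.mk (I ⊔ Ideal.span {f}) p := rfl
    rw [LinearMap.mem_ker, this, Ideal.Quotient.eq_zero_iff_mem, sup_comm,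
      Ideal.mem_span_singleton_sup]
    constructor
    · rintro ⟨q, r, hr, rfl⟩
      exact ⟨Ideal.Quotient.mk I q, by
        simp [Ideal.Quotient.eq_zero_iff_mem.mpr hr, mul_comm]⟩
    · rintro ⟨y, hy⟩
      obtain ⟨q, rfl⟩ := Ideal.Quotient.mk_surjective y
      refine ⟨q, p - q * f, ?_, by ring⟩
      rw [← Ideal.Quotient.eq_zero_iff_mem, map_sub, ← hy]
      simp [mul_comm]
  rw [← hker, ← g.finrank_range_add_finrank_ker, LinearMap.range_eq_top.mpr hg, finrank_top,
    add_comm, Submodule.add_eq_sup]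

/-- **Hyperplane case of Theorem 1.6, part (2)**: if some hyperplane direction
through the origin fails to be `m`-rich for the homogeneous 0-dimensional scheme
defined by `I`, then the `2m`-rich hyperplane directions lie on a hypersurface of
degree at most `C₂·N/m` in `ℙ^{n-1}`. -/
theorem rich_hyperplanes_on_hypersurface (n : ℕ) (hn : 2 ≤ n) :
    ∃ C₂ : ℝ, 0 < C₂ ∧
      ∀ (𝕜 : Type) [Field 𝕜] [IsAlgClosed 𝕜],
      ∀ I : Ideal (MvPolynomial (Fin n) 𝕜),
        IsHomogeneousIdeal I →
        FiniteDimensional 𝕜 (MvPolynomial (Fin n) 𝕜 ⧸ I) →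
        ∀ m : ℕ, 1 ≤ m →
        (∃ a₀ : Fin n → 𝕜, a₀ ≠ 0 ∧
          Module.finrank 𝕜 (MvPolynomial (Fin n) 𝕜 ⧸
            (I + Ideal.span {∑ i, MvPolynomial.C (a₀ i) * MvPolynomial.X i})) < m) →
        ∃ P : MvPolynomial (Fin n) 𝕜,
          P ≠ 0 ∧ (∃ d : ℕ, P.IsHomogeneous d) ∧
          (P.totalDegree : ℝ) ≤
            C₂ * (Module.finrank 𝕜 (MvPolynomial (Fin n) 𝕜 ⧸ I) : ℝ) / (m : ℝ) ∧
          ∀ a : Fin n → 𝕜, a ≠ 0 →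
            2 * m ≤
              Module.finrank 𝕜 (MvPolynomial (Fin n) 𝕜 ⧸
                (I + Ideal.span {∑ i, MvPolynomial.C (a i) * MvPolynomial.X i})) →
            MvPolynomial.eval a P = 0 := by
  refine ⟨n, by positivity, fun K _ _ I _ _ m hm ⟨a₀, _, ha₀⟩ ↦ ?_⟩
  set N := Module.finrank K (MvPolynomial (Fin n) K ⧸ I) with hN
  let T (i : Fin n) : (MvPolynomial (Fin n) K ⧸ I) →ₗ[K] (MvPolynomial (Fin n) K ⧸ I) :=
    LinearMap.mulLeft K (Ideal.Quotient.mk I (X i))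
  have hT (a : Fin n → K) : LinearMap.mulLeft K (Ideal.Quotient.mk I (∑ i, C (a i) * X i)) =
      ∑ i, a i • T i := by
    have h (i : Fin n) : Ideal.Quotient.mk I (C (a i) * X i) =
        a i • Ideal.Quotient.mk I (X i) := by
      rw [C_mul']
      rfl
    refine LinearMap.ext fun x ↦ ?_
    simp only [T, LinearMap.mulLeft_apply, LinearMap.sum_apply, LinearMap.smul_apply, map_sum, h,
      Finset.sum_mul, smul_mul_assoc]
  have hrank (a : Fin n → K) := hT a ▸
    finrank_range_mulLeft_add_finrank_quotient (K := K) I (∑ i, C (a i) * X i)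
  by_cases hNm : N < 2 * m
  · refine ⟨1, one_ne_zero, ⟨0, isHomogeneous_one _ _⟩, ?_, fun a _ ha ↦ ?_⟩
    · rw [totalDegree_one, Nat.cast_zero]
      positivity
    · have := hrank a
      omega
  push Not at hNm
  have hq : 2 ≤ N / m := (Nat.le_div_iff_mul_le hm).mpr hNm
  obtain ⟨e, he⟩ : ∃ e, n * (N / m) = e + 1 := Nat.exists_eq_succ_of_ne_zero (by positivity)
  obtain ⟨P, hP0, hPh, hP⟩ := exists_isHomogeneous_eval_eq_zero_of_finrank_range_le T a₀
    (N - 2 * m) e (by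
      have h0 := hrank a₀
      set r := Module.finrank K (LinearMap.range (∑ i, a₀ i • T i))
      have hpos : 0 < n.multichoose e := by
        rw [Nat.multichoose_eq]
        exact Nat.choose_pos (by omega)
      have hsucc := Nat.succ_mul_multichoose_succ n e
      have hdiv : N < m * (N / m) + m := by
        have := Nat.div_add_mod N m
        have := Nat.mod_lt N hm
        omega
      obtain ⟨k, hk⟩ := Nat.exists_eq_add_of_le hNm
      have hk' : N - 2 * m = k := by omega
      have hr : k + m + 1 ≤ r := by omega
      have hme : n * k ≤ m * (e + 1) := by
        rw [← he]
        calc n * k ≤ n * (m * (N / m)) := Nat.mul_le_mul_left _ (by omega)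
          _ = m * (n * (N / m)) := by ring
      have hlt : k * (n + e) < r * (e + 1) := by nlinarith
      rw [Fintype.card_fin, hk']
      refine lt_of_mul_lt_mul_left (a := e + 1) ?_ (Nat.zero_le _)
      calc (e + 1) * (k * n.multichoose (e + 1)) = k * (n + e) * n.multichoose e := by
            rw [mul_left_comm, hsucc, mul_assoc]
        _ < r * (e + 1) * n.multichoose e := Nat.mul_lt_mul_of_pos_right hlt hpos
        _ = _ := by ring)
  refine ⟨P, hP0, ⟨_, hPh⟩, ?_, fun a _ ha ↦ hP a ?_⟩
  · rw [hPh.totalDegree hP0, ← he, mul_div_assoc]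
    push_cast
    gcongr
    exact Nat.cast_div_le
  · have := hrank a
    omega
end

section
/- Let Γ be a Borel-fixed set of monomials in m variables, and define the frontier of Γ to be the set of monomials μ ∈ Γ such that μ·x_i ∉ Γ for every variable x_i. Then the cardinality of the frontier of Γ is at most the cardinality of the set of monomials in Γ in which the power of the first variable is 0; indeed, no two distinct elements of the frontier differ by a power of the first variable. -/
/-- If `nu` lies in a divisor-closed set and `mu + e_i` does not, and `mu`, `nu` agree away from
the `i`-th coordinate, then `nu i ≤ mu i`. -/
theorem apply_le_of_add_single_notMem {ι : Type*} [DecidableEq ι] {Γ : Finset (ι → ℕ)}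
    (hΓ : ∀ lam ∈ Γ, ∀ mu : ι → ℕ, (∀ i, mu i ≤ lam i) → mu ∈ Γ) {mu nu : ι → ℕ} {i : ι}
    (hmu : mu + Pi.single i 1 ∉ Γ) (hnu : nu ∈ Γ) (h : ∀ j, j ≠ i → mu j = nu j) :
    nu i ≤ mu i := by
  by_contra! hlt
  refine hmu (hΓ nu hnu _ fun j => ?_)
  by_cases hj : j = i
  · subst hj
    simpa using hlt
  · simp [hj, h j hj]

/-- A Borel-fixed set of monomials in `m` variables (identified with exponent
vectors in `ℕ^m`): a finite set closed under divisibility and under Borel moves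
`x_j ↦ x_i` for `i < j`. -/
def BorelFixed {m : ℕ} (Γ : Finset (Fin m → ℕ)) : Prop :=
  (∀ lam ∈ Γ, ∀ mu : Fin m → ℕ, (∀ i, mu i ≤ lam i) → mu ∈ Γ) ∧
  (∀ lam ∈ Γ, ∀ i j : Fin m, i < j → 0 < lam j →
    (lam - Pi.single j 1 + Pi.single i 1) ∈ Γ)

/-- The frontier of a Borel-fixed set of monomials `Γ` — the monomials
`μ ∈ Γ` with `μ·x_i ∉ Γ` for every variable `x_i` — has cardinality at most that
of the set of monomials of `Γ` not divisible by the first variable; indeed, no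
two distinct elements of the frontier differ by a power of the first variable. -/
theorem borel_frontier_card_le (m : ℕ) [NeZero m] (Γ : Finset (Fin m → ℕ))
    (hB : BorelFixed Γ) :
    (Γ.filter fun mu => ∀ i : Fin m, mu + Pi.single i 1 ∉ Γ).card ≤
      (Γ.filter fun mu => mu 0 = 0).card ∧
    ∀ mu ∈ Γ.filter fun mu => ∀ i : Fin m, mu + Pi.single i 1 ∉ Γ,
      ∀ nu ∈ Γ.filter fun nu => ∀ i : Fin m, nu + Pi.single i 1 ∉ Γ,
        (∃ t : ℕ, nu = mu + Pi.single 0 t ∨ mu = nu + Pi.single 0 t) →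
        mu = nu := by
  have key : ∀ mu ∈ Γ.filter fun mu => ∀ i : Fin m, mu + Pi.single i 1 ∉ Γ,
      ∀ nu ∈ Γ.filter fun nu => ∀ i : Fin m, nu + Pi.single i 1 ∉ Γ,
        (∀ j, j ≠ 0 → mu j = nu j) → mu = nu := by
    intro mu hmu nu hnu h
    rw [Finset.mem_filter] at hmu hnu
    funext j
    by_cases hj : j = 0
    · subst hj
      exact le_antisymm
        (apply_le_of_add_single_notMem hB.1 (hnu.2 0) hmu.1 fun j hj => (h j hj).symm)
        (apply_le_of_add_single_notMem hB.1 (hmu.2 0) hnu.1 h)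
    · exact h j hj
  refine ⟨Finset.card_le_card_of_injOn (fun mu => Function.update mu 0 0) ?_ ?_, ?_⟩
  · intro mu hmu
    have hmem := (Finset.mem_filter.mp hmu).1
    refine Finset.mem_filter.mpr ⟨hB.1 mu hmem _ fun j => ?_, by simp⟩
    by_cases hj : j = 0
    · simp [hj]
    · simp [hj]
  · intro mu hmu nu hnu h
    refine key mu hmu nu hnu fun j hj => ?_
    simpa [hj] using congrFun h j
  · rintro mu hmu nu hnu ⟨t, h | h⟩ <;>
      exact key mu hmu nu hnu fun j hj => by simp [h, hj]
end
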